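/- arXiv:1305.3207 — 3 statements merged into one kernel-verified Lean document; each statement's English description precedes it below -/
import Mathlib

section
/- There exist universal constants C, c > 0 such that for all integers k, t ≥ 1, d ≥ 0, all ε ∈ (0,1) and all τ ≥ 0, there is a sample size m ≤ C·(d+1)·k·t·(log((d+1)kt/ε))^c / ε² and a learning algorithm A using m samples over [−1,1) such that: for every ε/(64·kt(d+1))-well-behaved probability distribution p over [−1,1) that is a k-mixture of (τ,t)-piecewise degree-d distributions, with probability at least 9/10 over m i.i.d. samples s drawn from p, A(s) is a (2kt−1)-piecewise degree-d distribution satisfying d_TV(p, A(s)) ≤ 3·τ·(1+ε) + C·ε. (Theorem thm:learn-wb-mix.) -/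
open MeasureTheory Set
open scoped ENNReal

noncomputable def tvDist (p q : Measure ℝ) : ℝ :=
  ⨆ A : {S : Set ℝ // MeasurableSet S}, |(p A.1).toReal - (q A.1).toReal|

def IsPiecewisePoly (a b : ℝ) (t d : ℕ) (f : ℝ → ℝ) : Prop :=
  ∃ x : Fin (t + 1) → ℝ, x 0 = a ∧ x (Fin.last t) = b ∧ Monotone x ∧
    ∀ i : Fin t, ∃ P : Polynomial ℝ, P.natDegree ≤ d ∧
      ∀ y ∈ Set.Ico (x i.castSucc) (x i.succ), f y = P.eval y

def IsPiecewisePolyDist (q : Measure ℝ) (a b : ℝ) (t d : ℕ) : Prop :=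
  IsProbabilityMeasure q ∧
  ∃ f : ℝ → ℝ, (∀ y ∈ Set.Ico a b, 0 ≤ f y) ∧
    q = (volume.restrict (Set.Ico a b)).withDensity (fun y => ENNReal.ofReal (f y)) ∧
    IsPiecewisePoly a b t d f

noncomputable def optTD (p : Measure ℝ) (t d : ℕ) : ℝ :=
  sInf {x : ℝ | ∃ q : Measure ℝ, IsPiecewisePolyDist q (-1) 1 t d ∧ x = tvDist p q}

noncomputable def samples (p : Measure ℝ) (m : ℕ) : Measure (Fin m → ℝ) :=
  Measure.pi fun _ => p

section TotalVariation

lemma bddAbove_tvDist (p q : Measure ℝ) [IsProbabilityMeasure p] [IsProbabilityMeasure q] :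
    BddAbove (Set.range fun A : {S : Set ℝ // MeasurableSet S} =>
      |(p A.1).toReal - (q A.1).toReal|) := by
  refine ⟨1, ?_⟩
  rintro _ ⟨A, rfl⟩
  have h1 : p.real A.1 ≤ 1 := measureReal_le_one
  have h2 : q.real A.1 ≤ 1 := measureReal_le_one
  have h3 : 0 ≤ p.real A.1 := measureReal_nonneg
  have h4 : 0 ≤ q.real A.1 := measureReal_nonneg
  change |p.real A.1 - q.real A.1| ≤ 1
  rw [abs_le]
  constructor <;> linarith

lemma abs_sub_le_tvDist (p q : Measure ℝ) [IsProbabilityMeasure p] [IsProbabilityMeasure q]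
    {S : Set ℝ} (hS : MeasurableSet S) : |p.real S - q.real S| ≤ tvDist p q :=
  le_ciSup (bddAbove_tvDist p q) (⟨S, hS⟩ : {S : Set ℝ // MeasurableSet S})

lemma tvDist_le_of_forall {p q : Measure ℝ} {r : ℝ}
    (h : ∀ S, MeasurableSet S → |p.real S - q.real S| ≤ r) : tvDist p q ≤ r :=
  have : Nonempty {S : Set ℝ // MeasurableSet S} := ⟨⟨∅, MeasurableSet.empty⟩⟩
  ciSup_le fun A => h A.1 A.2

lemma tvDist_le_one (p q : Measure ℝ) [IsProbabilityMeasure p] [IsProbabilityMeasure q] :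
    tvDist p q ≤ 1 := by
  refine tvDist_le_of_forall fun S _ => ?_
  have h1 : p.real S ≤ 1 := measureReal_le_one
  have h2 : q.real S ≤ 1 := measureReal_le_one
  have h3 : 0 ≤ p.real S := measureReal_nonneg
  have h4 : 0 ≤ q.real S := measureReal_nonneg
  rw [abs_le]
  constructor <;> linarith

lemma tvDist_triangle (p q r : Measure ℝ) [IsProbabilityMeasure p] [IsProbabilityMeasure q]
    [IsProbabilityMeasure r] : tvDist p r ≤ tvDist p q + tvDist q r :=
  tvDist_le_of_forall fun _ hS => (abs_sub_le _ _ _).trans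
    (add_le_add (abs_sub_le_tvDist p q hS) (abs_sub_le_tvDist q r hS))

lemma tvDist_sum_le {k : ℕ} {μ : Fin k → ℝ≥0∞} (hμ : ∑ j, μ j = 1) {p q : Fin k → Measure ℝ}
    (hp : ∀ j, IsProbabilityMeasure (p j)) (hq : ∀ j, IsProbabilityMeasure (q j)) {τ : ℝ}
    (h : ∀ j, tvDist (p j) (q j) ≤ τ) : tvDist (∑ j, μ j • p j) (∑ j, μ j • q j) ≤ τ := by
  have hfin : ∀ j, μ j ≠ ∞ := fun j hj => by
    have : μ j ≤ 1 := hμ ▸ Finset.single_le_sum (fun _ _ => zero_le) (Finset.mem_univ j)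
    simp [hj] at this
  have hsum : ∑ j, (μ j).toReal = 1 := by
    rw [← ENNReal.toReal_sum fun j _ => hfin j, hμ, ENNReal.toReal_one]
  have key : ∀ (p : Fin k → Measure ℝ), (∀ j, IsProbabilityMeasure (p j)) → ∀ S,
      (∑ j, μ j • p j : Measure ℝ).real S = ∑ j, (μ j).toReal * (p j).real S := by
    intro p hp S
    simp only [Measure.real, Measure.finsetSum_apply, Measure.smul_apply, smul_eq_mul]
    rw [ENNReal.toReal_sum fun j _ => ENNReal.mul_ne_top (hfin j) (measure_ne_top _ _)]
    simp [ENNReal.toReal_mul]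
  refine tvDist_le_of_forall fun S hS => ?_
  rw [key p hp, key q hq, ← Finset.sum_sub_distrib]
  calc |∑ j, ((μ j).toReal * (p j).real S - (μ j).toReal * (q j).real S)|
      ≤ ∑ j, |(μ j).toReal * (p j).real S - (μ j).toReal * (q j).real S| :=
        Finset.abs_sum_le_sum_abs _ _
    _ ≤ ∑ j, (μ j).toReal * τ := by
        refine Finset.sum_le_sum fun j _ => ?_
        rw [← mul_sub, abs_mul, abs_of_nonneg ENNReal.toReal_nonneg]
        exact mul_le_mul_of_nonneg_left ((abs_sub_le_tvDist _ _ hS).trans (h j))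
          ENNReal.toReal_nonneg
    _ = τ := by rw [← Finset.sum_mul, hsum, one_mul]

/-- Scheffé's identity: a set on which `p` dominates and off which `q` dominates realises the
total variation distance. -/
lemma tvDist_le_of_dominates {p q : Measure ℝ} [IsProbabilityMeasure p] [IsProbabilityMeasure q]
    {A : Set ℝ} (hA : MeasurableSet A)
    (h1 : ∀ S, MeasurableSet S → S ⊆ A → q S ≤ p S)
    (h2 : ∀ S, MeasurableSet S → S ⊆ Aᶜ → p S ≤ q S) :
    tvDist p q ≤ p.real A - q.real A := by
  have h1' : ∀ S, MeasurableSet S → S ⊆ A → q.real S ≤ p.real S := fun S hS hSA =>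
    ENNReal.toReal_mono (measure_ne_top _ _) (h1 S hS hSA)
  have h2' : ∀ S, MeasurableSet S → S ⊆ Aᶜ → p.real S ≤ q.real S := fun S hS hSA =>
    ENNReal.toReal_mono (measure_ne_top _ _) (h2 S hS hSA)
  have key : ∀ S, MeasurableSet S → p.real S - q.real S ≤ p.real A - q.real A := by
    intro S hS
    have e1 := measureReal_inter_add_sdiff (μ := p) (s := S) hA
    have e2 := measureReal_inter_add_sdiff (μ := q) (s := S) hA
    have e3 := measureReal_inter_add_sdiff (μ := p) (s := A) hS
    have e4 := measureReal_inter_add_sdiff (μ := q) (s := A) hS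
    rw [inter_comm] at e3 e4
    have i1 := h2' (S \ A) (hS.diff hA) fun x hx => hx.2
    have i2 := h1' (A \ S) (hA.diff hS) fun x hx => hx.1
    linarith
  refine tvDist_le_of_forall fun S hS => abs_le.2 ⟨?_, key S hS⟩
  have := key Sᶜ hS.compl
  rw [probReal_compl_eq_one_sub hS, probReal_compl_eq_one_sub hS] at this
  linarith

/-- Absolutely continuous probability measures form a separable space in total variation. -/
lemma exists_seq_tvDist_lt {F : Set (Measure ℝ)} (hne : F.Nonempty)
    (hF : ∀ q ∈ F, IsProbabilityMeasure q ∧ q ≪ volume) {ε : ℝ} (hε : 0 < ε) :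
    ∃ u : ℕ → Measure ℝ, (∀ n, u n ∈ F) ∧ ∀ q ∈ F, ∃ n, tvDist q (u n) ≤ ε := by
  classical
  have hint : ∀ q : F, Integrable (fun x => (q.1.rnDeriv volume x).toReal) (volume : Measure ℝ) :=
    fun q => by
      have := (hF q.1 q.2).1
      exact Measure.integrable_toReal_rnDeriv
  let G : F → Lp ℝ 1 (volume : Measure ℝ) := fun q => (hint q).toL1 _
  have : Fact ((1 : ℝ≥0∞) ≠ ∞) := ⟨ENNReal.one_ne_top⟩
  have : Nonempty F := hne.to_subtype
  have : Nonempty (Set.range G) := (Set.range_nonempty G).to_subtype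
  have hsel : ∀ n, ∃ q : F, G q = (TopologicalSpace.denseSeq (Set.range G) n).1 := fun n =>
    (TopologicalSpace.denseSeq (Set.range G) n).2
  choose v hv using hsel
  refine ⟨fun n => (v n).1, fun n => (v n).2, fun q hq => ?_⟩
  obtain ⟨_, hn, n, rfl⟩ := Metric.dense_iff.1
    (TopologicalSpace.denseRange_denseSeq (Set.range G)) ⟨G ⟨q, hq⟩, ⟨q, hq⟩, rfl⟩ ε hε
  refine ⟨n, ?_⟩
  rw [Metric.mem_ball, Subtype.dist_eq, ← hv n, dist_comm] at hn
  have hd : dist (G ⟨q, hq⟩) (G (v n)) =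
      ∫ x, ‖(q.rnDeriv volume x).toReal - ((v n).1.rnDeriv volume x).toReal‖ := by
    rw [dist_eq_norm, ← Integrable.toL1_sub, L1.norm_eq_integral_norm]
    refine integral_congr_ae ?_
    filter_upwards [Integrable.coeFn_toL1 ((hint ⟨q, hq⟩).sub (hint (v n)))] with x hx
    rw [hx]
    rfl
  obtain ⟨hq1, hq2⟩ := hF q hq
  obtain ⟨hv1, hv2⟩ := hF _ (v n).2
  refine tvDist_le_of_forall fun S hS => le_trans ?_ hn.le
  rw [hd, ← Measure.setIntegral_toReal_rnDeriv hq2 S, ← Measure.setIntegral_toReal_rnDeriv hv2 S,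
    ← integral_sub (hint ⟨q, hq⟩).integrableOn (hint (v n)).integrableOn, ← Real.norm_eq_abs]
  refine (norm_integral_le_integral_norm _).trans ?_
  exact setIntegral_le_integral ((hint ⟨q, hq⟩).sub (hint (v n))).norm
    (Filter.Eventually.of_forall fun _ => norm_nonneg _)

end TotalVariation

section Piecewise

/-- `f` agrees with a polynomial of degree at most `d` on every subinterval of `[a, b)` whose
interior avoids the finite set `B`. -/
def IsPolyOff (a b : ℝ) (B : Finset ℝ) (d : ℕ) (f : ℝ → ℝ) : Prop :=
  ∀ u v, a ≤ u → u < v → v ≤ b → (∀ β ∈ B, β ∉ Ioo u v) →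
    ∃ P : Polynomial ℝ, P.natDegree ≤ d ∧ ∀ y ∈ Ico u v, f y = P.eval y

lemma exists_mem_Ico_of_fin {a b : ℝ} {t : ℕ} {x : Fin (t + 1) → ℝ} (h0 : x 0 = a)
    (h1 : x (Fin.last t) = b) {y : ℝ} (hy : y ∈ Ico a b) :
    ∃ i : Fin t, y ∈ Ico (x i.castSucc) (x i.succ) := by
  by_contra! hcon
  have : ∀ i : Fin (t + 1), x i ≤ y := by
    intro i
    induction i using Fin.induction with
    | zero => exact h0 ▸ hy.1
    | succ i ih => exact not_lt.1 fun h => hcon i ⟨ih, h⟩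
  exact absurd (this (Fin.last t)) (not_le.2 (h1 ▸ hy.2))

lemma Ico_subset_of_fin {a b : ℝ} {t : ℕ} {x : Fin (t + 1) → ℝ} (h0 : x 0 = a)
    (h1 : x (Fin.last t) = b) (hx : Monotone x) (i : Fin t) :
    Ico (x i.castSucc) (x i.succ) ⊆ Ico a b :=
  Ico_subset_Ico (h0 ▸ hx (Fin.zero_le _)) (h1 ▸ hx (Fin.le_last _))

lemma IsPiecewisePoly.exists_isPolyOff {a b : ℝ} {t d : ℕ} {f : ℝ → ℝ}
    (h : IsPiecewisePoly a b t d f) : ∃ B : Finset ℝ, B.card ≤ t - 1 ∧ IsPolyOff a b B d f := by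
  obtain ⟨x, h0, h1, -, hP⟩ := h
  refine ⟨Finset.univ.image fun i : Fin (t - 1) => x ⟨i.1 + 1, by omega⟩,
    Finset.card_image_le.trans (by simp), fun u v hu huv hv hB => ?_⟩
  obtain ⟨i, hi⟩ := exists_mem_Ico_of_fin h0 h1 (y := u) ⟨hu, huv.trans_le hv⟩
  have hvi : v ≤ x i.succ := by
    by_cases hit : i.1 + 1 = t
    · have : i.succ = Fin.last t := Fin.ext (by simpa using hit)
      rw [this, h1]
      exact hv
    · have hmem := hB (x i.succ)
        (Finset.mem_image.2 ⟨⟨i.1, by omega⟩, Finset.mem_univ _, rfl⟩)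
      exact not_lt.1 fun hlt => hmem ⟨hi.2, hlt⟩
  obtain ⟨P, hPd, hPe⟩ := hP i
  exact ⟨P, hPd, fun y hy => hPe y ⟨hi.1.trans hy.1, hy.2.trans_le hvi⟩⟩

lemma exists_monotone_partition (n : ℕ) : ∀ (B : Finset ℝ) (a b : ℝ), a ≤ b → B.card ≤ n →
    ∃ x : ℕ → ℝ, x 0 = a ∧ x (n + 1) = b ∧ Monotone x ∧
      ∀ i, ∀ β ∈ B, β ∈ Ioo a b → β ∉ Ioo (x i) (x (i + 1)) := by
  have trivial_case : ∀ (n : ℕ) (B : Finset ℝ) (a b : ℝ), a ≤ b → (∀ β ∈ B, β ∉ Ioo a b) →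
      ∃ x : ℕ → ℝ, x 0 = a ∧ x (n + 1) = b ∧ Monotone x ∧
        ∀ i, ∀ β ∈ B, β ∈ Ioo a b → β ∉ Ioo (x i) (x (i + 1)) := by
    intro n B a b hab hB
    refine ⟨fun i => if i = 0 then a else b, by simp, by simp, ?_,
      fun i β hβ h => absurd h (hB β hβ)⟩
    refine monotone_nat_of_le_succ fun i => ?_
    by_cases hi : i = 0 <;> simp [hi, hab]
  induction n with
  | zero =>
    intro B a b hab hB
    have : B = ∅ := Finset.card_eq_zero.1 (by omega)
    exact trivial_case 0 B a b hab (by simp [this])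
  | succ n ih =>
    intro B a b hab hB
    by_cases hne : ∃ β ∈ B, β ∈ Ioo a b
    swap
    · push Not at hne
      exact trivial_case (n + 1) B a b hab hne
    have hne' : (B.filter (· ∈ Ioo a b)).Nonempty := by
      obtain ⟨β, h1, h2⟩ := hne
      exact ⟨β, Finset.mem_filter.2 ⟨h1, h2⟩⟩
    set β := (B.filter (· ∈ Ioo a b)).min' hne'
    obtain ⟨hβB, hβI⟩ := Finset.mem_filter.1 (Finset.min'_mem _ hne')
    obtain ⟨x, hx0, hx1, hxm, hx⟩ := ih (B.erase β) β b hβI.2.le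
      (by rw [Finset.card_erase_of_mem hβB]; omega)
    refine ⟨fun i => if i = 0 then a else x (i - 1), by simp, by simp [hx1], ?_, ?_⟩
    · refine monotone_nat_of_le_succ fun i => ?_
      by_cases hi : i = 0
      · subst hi
        simp only [if_true, zero_add, one_ne_zero, if_false, Nat.sub_self, hx0]
        exact hβI.1.le
      · simpa [hi] using hxm (Nat.sub_le i 1)
    · intro i γ hγ hγI hmem
      have hle : β ≤ γ := Finset.min'_le _ _ (Finset.mem_filter.2 ⟨hγ, hγI⟩)
      by_cases hi : i = 0
      · subst hi
        simp only [hx0, zero_add, one_ne_zero, if_false, Nat.sub_self] at hmem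
        exact absurd hmem.2 (not_lt.2 hle)
      · simp only [hi, if_false, Nat.add_sub_cancel, Nat.succ_ne_zero] at hmem
        have hlt : β < γ := by
          have := hxm (Nat.zero_le (i - 1))
          rw [hx0] at this
          exact this.trans_lt hmem.1
        refine hx (i - 1) γ (Finset.mem_erase.2 ⟨hlt.ne', hγ⟩) ⟨hlt, hγI.2⟩ ?_
        rwa [Nat.sub_add_cancel (Nat.one_le_iff_ne_zero.2 hi)]

lemma IsPolyOff.isPiecewisePoly {a b : ℝ} {B : Finset ℝ} {n d : ℕ} {f : ℝ → ℝ} (hab : a ≤ b)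
    (h : IsPolyOff a b B d f) (hB : B.card + 1 ≤ n) : IsPiecewisePoly a b n d f := by
  obtain ⟨m, rfl⟩ : ∃ m, n = m + 1 := ⟨n - 1, by omega⟩
  obtain ⟨x, h0, h1, hm, hx⟩ := exists_monotone_partition m B a b hab (by omega)
  refine ⟨fun i => x i.1, by simpa using h0, by simpa using h1, fun i j hij => hm hij,
    fun i => ?_⟩
  simp only [Fin.val_castSucc, Fin.val_succ]
  rcases (hm (Nat.le_succ i.1)).eq_or_lt with heq | hlt
  · refine ⟨0, by simp, fun y hy => ?_⟩
    rw [Nat.succ_eq_add_one] at heq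
    simp [heq] at hy
  · have ha : a ≤ x i.1 := h0 ▸ hm (Nat.zero_le _)
    have hb : x (i.1 + 1) ≤ b := h1 ▸ hm (by omega)
    exact h _ _ ha hlt hb fun β hβ hmem =>
      hx i.1 β hβ ⟨ha.trans_lt hmem.1, hmem.2.trans_le hb⟩ hmem

lemma IsPolyOff.mono {a b : ℝ} {B B' : Finset ℝ} {d : ℕ} {f : ℝ → ℝ} (h : IsPolyOff a b B d f)
    (hB : B ⊆ B') : IsPolyOff a b B' d f :=
  fun u v hu huv hv hβ => h u v hu huv hv fun β hm => hβ β (hB hm)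

lemma IsPolyOff.sub {a b : ℝ} {B : Finset ℝ} {d : ℕ} {f g : ℝ → ℝ} (hf : IsPolyOff a b B d f)
    (hg : IsPolyOff a b B d g) : IsPolyOff a b B d fun y => f y - g y := by
  intro u v hu huv hv hB
  obtain ⟨P, hP, hPe⟩ := hf u v hu huv hv hB
  obtain ⟨Q, hQ, hQe⟩ := hg u v hu huv hv hB
  exact ⟨P - Q, (Polynomial.natDegree_sub_le P Q).trans (max_le hP hQ), fun y hy => by
    simp only [hPe y hy, hQe y hy, Polynomial.eval_sub]⟩

lemma IsPolyOff.sum {a b : ℝ} {B : Finset ℝ} {d k : ℕ} {f : Fin k → ℝ → ℝ} (c : Fin k → ℝ)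
    (hf : ∀ j, IsPolyOff a b B d (f j)) : IsPolyOff a b B d fun y => ∑ j, c j * f j y := by
  intro u v hu huv hv hB
  choose P hP hPe using fun j => hf j u v hu huv hv hB
  refine ⟨∑ j, Polynomial.C (c j) * P j, Polynomial.natDegree_sum_le_of_forall_le _ _ fun j _ =>
    (Polynomial.natDegree_C_mul_le _ _).trans (hP j), fun y hy => ?_⟩
  rw [Polynomial.eval_finsetSum]
  refine Finset.sum_congr rfl fun j _ => ?_
  rw [hPe j y hy, Polynomial.eval_mul, Polynomial.eval_C]

lemma IsPiecewisePoly.sub {a b : ℝ} {n d : ℕ} {f g : ℝ → ℝ} (hab : a ≤ b) (hn : 1 ≤ n)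
    (hf : IsPiecewisePoly a b n d f) (hg : IsPiecewisePoly a b n d g) :
    IsPiecewisePoly a b (2 * n - 1) d fun y => f y - g y := by
  classical
  obtain ⟨B, hB, hfB⟩ := hf.exists_isPolyOff
  obtain ⟨B', hB', hgB⟩ := hg.exists_isPolyOff
  refine ((hfB.mono Finset.subset_union_left).sub
    (hgB.mono (Finset.subset_union_right (s₁ := B)))).isPiecewisePoly hab ?_
  have := Finset.card_union_le B B'
  omega

lemma IsPiecewisePoly.sum {a b : ℝ} {t d k n : ℕ} {f : Fin k → ℝ → ℝ} (hab : a ≤ b)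
    (hn : k * (t - 1) + 1 ≤ n) (c : Fin k → ℝ) (hf : ∀ j, IsPiecewisePoly a b t d (f j)) :
    IsPiecewisePoly a b n d fun y => ∑ j, c j * f j y := by
  classical
  choose B hB hfB using fun j => (hf j).exists_isPolyOff
  refine (IsPolyOff.sum c fun j =>
    (hfB j).mono (Finset.subset_biUnion_of_mem B (Finset.mem_univ j))).isPiecewisePoly hab ?_
  have := Finset.card_biUnion_le_card_mul Finset.univ B (t - 1) fun j _ => hB j
  simp only [Finset.card_univ, Fintype.card_fin] at this
  omega

lemma IsPiecewisePoly.aemeasurable {a b : ℝ} {t d : ℕ} {f : ℝ → ℝ}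
    (h : IsPiecewisePoly a b t d f) : AEMeasurable f (volume.restrict (Ico a b)) := by
  obtain ⟨x, h0, h1, -, hP⟩ := h
  have hsub : Ico a b ⊆ ⋃ i : Fin t, Ico (x i.castSucc) (x i.succ) := fun y hy =>
    mem_iUnion.2 (exists_mem_Ico_of_fin h0 h1 hy)
  refine AEMeasurable.mono_set hsub (aemeasurable_iUnion_iff.2 fun i => ?_)
  obtain ⟨P, -, hPe⟩ := hP i
  refine (P.continuous.measurable.aemeasurable (μ := volume.restrict _)).congr ?_
  filter_upwards [ae_restrict_mem measurableSet_Ico] with y hy using (hPe y hy).symm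

lemma IsPiecewisePoly.measurableSet_pos {a b : ℝ} {t d : ℕ} {f : ℝ → ℝ}
    (h : IsPiecewisePoly a b t d f) : MeasurableSet {y | y ∈ Ico a b ∧ 0 < f y} := by
  obtain ⟨x, h0, h1, hx, hP⟩ := h
  choose P _ hPe using hP
  have : {y | y ∈ Ico a b ∧ 0 < f y} =
      ⋃ i : Fin t, Ico (x i.castSucc) (x i.succ) ∩ {y | 0 < (P i).eval y} := by
    ext y
    simp only [mem_ofPred_eq, mem_iUnion, mem_inter_iff]
    constructor
    · rintro ⟨hy, hpos⟩
      obtain ⟨i, hi⟩ := exists_mem_Ico_of_fin h0 h1 hy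
      exact ⟨i, hi, hPe i y hi ▸ hpos⟩
    · rintro ⟨i, hi, hpos⟩
      exact ⟨Ico_subset_of_fin h0 h1 hx i hi, (hPe i y hi).symm ▸ hpos⟩
  rw [this]
  exact MeasurableSet.iUnion fun i => measurableSet_Ico.inter
    (measurableSet_lt measurable_const (P i).continuous.measurable)

/-- Membership in `A` is constant along every interval avoiding the points `Z l`. -/
def ConstantOff {D : ℕ} (Z : Fin D → ℝ) (A : Set ℝ) : Prop :=
  ∀ x y, x ≤ y → (∀ l, Z l ∉ Icc x y) → (x ∈ A ↔ y ∈ A)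

lemma IsPiecewisePoly.exists_constantOff {a b : ℝ} {t d : ℕ} {f : ℝ → ℝ}
    (h : IsPiecewisePoly a b t d f) {D : ℕ} (hD : (t + 1) * (d + 1) ≤ D) :
    ∃ Z : Fin D → ℝ, ConstantOff Z {y | y ∈ Ico a b ∧ 0 < f y} := by
  classical
  obtain ⟨x, h0, h1, hx, hP⟩ := h
  choose P hPd hPe using hP
  set S : Finset ℝ := Finset.univ.image x ∪ Finset.univ.biUnion fun i => (P i).roots.toFinset
  have hcard : S.card ≤ D := by
    refine (Finset.card_union_le _ _).trans (le_trans ?_ hD)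
    have e1 : (Finset.univ.image x).card ≤ t + 1 := Finset.card_image_le.trans (by simp)
    have e2 := Finset.card_biUnion_le_card_mul Finset.univ (fun i => (P i).roots.toFinset) d
      fun i _ => (Multiset.toFinset_card_le _).trans ((Polynomial.card_roots' _).trans (hPd i))
    simp only [Finset.card_univ, Fintype.card_fin] at e2
    nlinarith
  refine ⟨fun l => S.toList.getD l.1 0, fun u v huv hZ => ?_⟩
  have hSnot : ∀ z ∈ S, z ∉ Icc u v := by
    intro z hz
    obtain ⟨n, hn, rfl⟩ := List.mem_iff_getElem.1 (Finset.mem_toList.2 hz)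
    have hn' : n < D := by
      rw [Finset.length_toList] at hn
      omega
    have : S.toList.getD n 0 ∉ Icc u v := hZ ⟨n, hn'⟩
    rwa [List.getD_eq_getElem _ _ hn] at this
  have hxS : ∀ i, x i ∉ Icc u v := fun i =>
    hSnot _ (Finset.mem_union_left _ (Finset.mem_image_of_mem _ (Finset.mem_univ i)))
  have ha : a ∉ Icc u v := h0 ▸ hxS 0
  have hb : b ∉ Icc u v := h1 ▸ hxS (Fin.last t)
  simp only [mem_Icc, not_and_or, not_le] at ha hb hxS
  by_cases hu : u ∈ Ico a b
  swap
  · have hv : v ∉ Ico a b := by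
      simp only [mem_Ico, not_and_or, not_le, not_lt] at hu ⊢
      rcases hu with hu | hu
      · rcases ha with ha | ha
        · exact absurd ha (not_lt.2 hu.le)
        · exact Or.inl ha
      · exact Or.inr (hu.trans huv)
    exact iff_of_false (fun h => hu h.1) fun h => hv h.1
  obtain ⟨i, hi⟩ := exists_mem_Ico_of_fin h0 h1 hu
  have hvi : v < x i.succ := by
    rcases hxS i.succ with h | h
    · exact absurd h (not_lt.2 hi.2.le)
    · exact h
  have hI : Icc u v ⊆ Ico (x i.castSucc) (x i.succ) := fun y hy =>
    ⟨hi.1.trans hy.1, hy.2.trans_lt hvi⟩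
  have hmu : u ∈ Icc u v := ⟨le_rfl, huv⟩
  have hmv : v ∈ Icc u v := ⟨huv, le_rfl⟩
  have hv : v ∈ Ico a b := Ico_subset_of_fin h0 h1 hx i (hI hmv)
  simp only [mem_ofPred_eq, hu, hv, true_and, hPe i u (hI hmu), hPe i v (hI hmv)]
  by_cases hPi : P i = 0
  · simp [hPi]
  have hne : ∀ y ∈ Icc u v, (P i).eval y ≠ 0 := fun y hy h0 =>
    hSnot y (Finset.mem_union_right _ (Finset.mem_biUnion.2 ⟨i, Finset.mem_univ _,
      Multiset.mem_toFinset.2 ((Polynomial.mem_roots hPi).2 h0)⟩)) hy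
  have hc : ContinuousOn (fun y => (P i).eval y) (Icc u v) := (P i).continuous.continuousOn
  constructor
  · intro hpos
    by_contra hcon
    obtain ⟨y, hy, hy0⟩ := intermediate_value_Icc' huv hc ⟨not_lt.1 hcon, hpos.le⟩
    exact hne y hy hy0
  · intro hpos
    by_contra hcon
    obtain ⟨y, hy, hy0⟩ := intermediate_value_Icc huv hc ⟨not_lt.1 hcon, hpos.le⟩
    exact hne y hy hy0

end Piecewise

section UniformDeviation

/-- The empirical frequency of `B` in the sample `s`. -/
noncomputable def empFreq {m : ℕ} (s : Fin m → ℝ) (B : Set ℝ) : ℝ :=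
  (∑ i, B.indicator (fun _ => (1 : ℝ)) (s i)) / m

lemma measurable_empFreq {m : ℕ} {B : Set ℝ} (hB : MeasurableSet B) :
    Measurable fun s : Fin m → ℝ => empFreq s B :=
  (Finset.measurable_sum _ fun i _ =>
    (measurable_const.indicator hB).comp (measurable_pi_apply i)).div_const _

lemma empFreq_mono {m : ℕ} (s : Fin m → ℝ) {B B' : Set ℝ} (h : B ⊆ B') :
    empFreq s B ≤ empFreq s B' :=
  div_le_div_of_nonneg_right (Finset.sum_le_sum fun i _ =>
    indicator_le_indicator_of_subset h (fun _ => zero_le_one) (s i)) (Nat.cast_nonneg m)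

lemma empFreq_compl {m : ℕ} (hm : 0 < m) (s : Fin m → ℝ) (B : Set ℝ) :
    empFreq s Bᶜ = 1 - empFreq s B := by
  have hm' : (m : ℝ) ≠ 0 := by positivity
  have : ∀ i, Bᶜ.indicator (fun _ => (1 : ℝ)) (s i) =
      1 - B.indicator (fun _ => (1 : ℝ)) (s i) := fun i => by
    by_cases h : s i ∈ B <;> simp [h]
  simp only [empFreq, this, Finset.sum_sub_distrib]
  simp [sub_div, hm']

instance (p : Measure ℝ) [IsProbabilityMeasure p] (m : ℕ) :
    IsProbabilityMeasure (samples p m) := by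
  unfold samples
  infer_instance

lemma samples_real_empFreq_ge_le (p : Measure ℝ) [IsProbabilityMeasure p] {m : ℕ} (hm : 0 < m)
    {B : Set ℝ} (hB : MeasurableSet B) {ε : ℝ} (hε : 0 ≤ ε) :
    (samples p m).real {s | p.real B + ε ≤ empFreq s B} ≤ Real.exp (-2 * m * ε ^ 2) := by
  have hm' : (0 : ℝ) < m := by positivity
  have hX : Measurable (B.indicator fun _ => (1 : ℝ)) := measurable_const.indicator hB
  have hint : ∫ x, B.indicator (fun _ => (1 : ℝ)) x ∂p = p.real B := by
    simp [integral_indicator hB]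
  have hmap : ∀ i, (samples p m).map (fun s => s i) = p := fun i =>
    (measurePreserving_eval (fun _ : Fin m => p) i).map_eq
  have hint' : ∀ i, ∫ s, B.indicator (fun _ => (1 : ℝ)) (s i) ∂(samples p m) = p.real B := by
    intro i
    rw [← hint]
    conv_rhs => rw [← hmap i]
    rw [integral_map (measurable_pi_apply i).aemeasurable hX.aestronglyMeasurable]
  have hind : ProbabilityTheory.iIndepFun
      (fun (i : Fin m) (s : Fin m → ℝ) => B.indicator (fun _ => (1 : ℝ)) (s i) - p.real B)
      (samples p m) :=
    ProbabilityTheory.iIndepFun_pi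
      (X := fun (_ : Fin m) x => B.indicator (fun _ => (1 : ℝ)) x - p.real B)
      (μ := fun _ : Fin m => p) fun i => (hX.sub_const _).aemeasurable
  have hsub : ∀ i ∈ (Finset.univ : Finset (Fin m)), ProbabilityTheory.HasSubgaussianMGF
      (fun s : Fin m → ℝ => B.indicator (fun _ => (1 : ℝ)) (s i) - p.real B)
      ((‖(1 : ℝ) - 0‖₊ / 2) ^ 2) (samples p m) := by
    intro i _
    have := ProbabilityTheory.hasSubgaussianMGF_of_mem_Icc (μ := samples p m) (a := 0) (b := 1)
      (X := fun s : Fin m → ℝ => B.indicator (fun _ => (1 : ℝ)) (s i))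
      (hX.comp (measurable_pi_apply i)).aemeasurable
      (Filter.Eventually.of_forall fun s => by
        by_cases h : s i ∈ B <;> simp [h])
    rwa [hint' i] at this
  have := ProbabilityTheory.HasSubgaussianMGF.measure_sum_ge_le_of_iIndepFun hind
    hsub (ε := m * ε) (by positivity)
  have hset : {s : Fin m → ℝ | p.real B + ε ≤ empFreq s B} =
      {s | m * ε ≤ ∑ i, (B.indicator (fun _ => (1 : ℝ)) (s i) - p.real B)} := by
    ext s
    simp only [mem_ofPred_eq, empFreq, le_div_iff₀ hm', Finset.sum_sub_distrib,
      Finset.sum_const, Finset.card_univ, Fintype.card_fin, nsmul_eq_mul]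
    constructor <;> intro h <;> linarith
  rw [hset]
  refine this.trans_eq ?_
  congr 1
  simp
  field_simp

lemma exists_monotone_grid (p : Measure ℝ) [IsProbabilityMeasure p] {δ : ℝ} (hδ : 0 < δ)
    (hatom : ∀ x, p {x} ≤ ENNReal.ofReal δ) {N : ℕ} (hN : 1 / δ < N) :
    ∃ φ : ℝ → Fin N, Monotone φ ∧ ∀ i, p.real (φ ⁻¹' {i}) ≤ 2 * δ := by
  have hlt : ∀ x, ⌊ProbabilityTheory.cdf p x / δ⌋₊ < N := fun x => by
    rw [Nat.floor_lt (div_nonneg (ProbabilityTheory.cdf_nonneg p x) hδ.le)]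
    exact lt_of_le_of_lt (div_le_div_of_nonneg_right (ProbabilityTheory.cdf_le_one p x) hδ.le) hN
  have hmono : Monotone fun x => (⟨⌊ProbabilityTheory.cdf p x / δ⌋₊, hlt x⟩ : Fin N) :=
    fun x y hxy => Nat.floor_mono
      (div_le_div_of_nonneg_right (ProbabilityTheory.monotone_cdf p hxy) hδ.le)
  refine ⟨_, hmono, fun i => ?_⟩
  set φ : ℝ → Fin N := fun x => ⟨⌊ProbabilityTheory.cdf p x / δ⌋₊, hlt x⟩
  have hmeas : MeasurableSet (φ ⁻¹' {i}) :=
    (ordConnected_singleton.preimage_mono hmono).measurableSet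
  have hIcc : ∀ u v, u ≤ v → φ u = i → φ v = i → p (Icc u v) ≤ ENNReal.ofReal (2 * δ) := by
    intro u v huv hu hv
    have hcdf : ProbabilityTheory.cdf p v - ProbabilityTheory.cdf p u ≤ δ := by
      have e1 := Nat.floor_le (div_nonneg (ProbabilityTheory.cdf_nonneg p u) hδ.le)
      have e2 := Nat.lt_floor_add_one (ProbabilityTheory.cdf p v / δ)
      have e3 : ⌊ProbabilityTheory.cdf p v / δ⌋₊ = ⌊ProbabilityTheory.cdf p u / δ⌋₊ :=
        congrArg Fin.val (hv.trans hu.symm)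
      rw [e3, div_lt_iff₀ hδ] at e2
      rw [le_div_iff₀ hδ] at e1
      linarith
    have hIoc : p (Ioc u v) ≤ ENNReal.ofReal δ := by
      have := StieltjesFunction.measure_Ioc (ProbabilityTheory.cdf p) u v
      rw [ProbabilityTheory.measure_cdf] at this
      rw [this]
      exact ENNReal.ofReal_le_ofReal hcdf
    rw [← Ioc_insert_left huv, two_mul, ENNReal.ofReal_add hδ.le hδ.le]
    exact (measure_union_le {u} (Ioc u v)).trans (add_le_add (hatom u) hIoc)
  refine ENNReal.toReal_le_of_le_ofReal (by positivity) (le_of_forall_lt fun r hr => ?_)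
  obtain ⟨K, hK, hKc, hrK⟩ := hmeas.exists_lt_isCompact hr
  refine hrK.trans_le ?_
  rcases K.eq_empty_or_nonempty with rfl | hne
  · simp
  have h1 := hK (hKc.sInf_mem hne)
  have h2 := hK (hKc.sSup_mem hne)
  refine (measure_mono fun x hx => ?_).trans
    (hIcc (sInf K) (sSup K) (csInf_le_csSup hne hKc.bddBelow hKc.bddAbove) h1 h2)
  exact ⟨csInf_le hKc.bddBelow hx, le_csSup hKc.bddAbove hx⟩

/-- The gap between consecutive values of `w` in which `i` lies. -/
def gapIndex {D N : ℕ} (w : Fin D → Fin N) (i : Fin N) : Fin (D + 1) :=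
  ⟨(Finset.univ.filter fun l => w l < i).card,
    Nat.lt_succ_of_le ((Finset.card_filter_le _ _).trans (by simp))⟩

/-- The union of the gaps of `w` selected by `σ`. -/
def gapUnion {D N : ℕ} (w : Fin D → Fin N) (σ : Fin (D + 1) → Bool) : Set (Fin N) :=
  {i | i ∉ range w ∧ σ (gapIndex w i) = true}

lemma ConstantOff.exists_gapUnion {D N : ℕ} {Z : Fin D → ℝ} {A : Set ℝ} (hA : ConstantOff Z A)
    {φ : ℝ → Fin N} (hφ : Monotone φ) :
    ∃ σ, φ ⁻¹' gapUnion (φ ∘ Z) σ ⊆ A ∧ A ⊆ φ ⁻¹' (gapUnion (φ ∘ Z) σ ∪ range (φ ∘ Z)) := by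
  classical
  have key : ∀ x y, x ≤ y → φ x ∉ range (φ ∘ Z) → φ y ∉ range (φ ∘ Z) →
      gapIndex (φ ∘ Z) (φ x) = gapIndex (φ ∘ Z) (φ y) → (x ∈ A ↔ y ∈ A) := by
    intro x y hxy hx hy hxyg
    refine hA x y hxy fun l hl => ?_
    have h1 : φ x < φ (Z l) := (hφ hl.1).lt_of_ne fun h => hx ⟨l, h.symm⟩
    have h2 : φ (Z l) < φ y := (hφ hl.2).lt_of_ne fun h => hy ⟨l, h⟩
    have hlt : (gapIndex (φ ∘ Z) (φ x)).1 < (gapIndex (φ ∘ Z) (φ y)).1 := by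
      simp only [gapIndex]
      refine Finset.card_lt_card ?_
      refine Finset.ssubset_iff_subset_ne.2 ⟨fun k hk => ?_, fun h => ?_⟩
      · rw [Finset.mem_filter] at hk ⊢
        exact ⟨hk.1, hk.2.trans_le (hφ hxy)⟩
      · have hl' : l ∈ Finset.univ.filter fun k => (φ ∘ Z) k < φ y :=
          Finset.mem_filter.2 ⟨Finset.mem_univ _, h2⟩
        rw [← h, Finset.mem_filter] at hl'
        exact absurd hl'.2 (not_lt.2 h1.le)
    exact hlt.ne (congrArg Fin.val hxyg)
  refine ⟨fun c => decide (∃ x ∈ A, φ x ∉ range (φ ∘ Z) ∧ gapIndex (φ ∘ Z) (φ x) = c), ?_, ?_⟩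
  · rintro y ⟨hy, hσ⟩
    obtain ⟨x, hxA, hx, hxy⟩ := of_decide_eq_true hσ
    rcases le_total x y with h | h
    · exact (key x y h hx hy hxy).1 hxA
    · exact (key y x h hy hx hxy.symm).2 hxA
  · intro x hx
    by_cases h : φ x ∈ range (φ ∘ Z)
    · exact Or.inr h
    · exact Or.inl ⟨h, decide_eq_true ⟨x, hx, h, rfl⟩⟩

/-- Uniform convergence of empirical frequencies over all sets that are constant off `D` points. -/
lemma exists_uniform_deviation (p : Measure ℝ) [IsProbabilityMeasure p] {δ : ℝ} (hδ : 0 < δ)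
    (hatom : ∀ x, p {x} ≤ ENNReal.ofReal δ) {N : ℕ} (hN : 1 / δ < N) {m D : ℕ} (hm : 0 < m)
    {ε : ℝ} (hε : 0 ≤ ε)
    (hbound : (N : ℝ) ^ D * 2 ^ (D + 2) * Real.exp (-2 * m * ε ^ 2) ≤ 1 / 10) :
    ∃ G : Set (Fin m → ℝ), 9 / 10 ≤ samples p m G ∧ ∀ s ∈ G, ∀ (A : Set ℝ) (Z : Fin D → ℝ),
      ConstantOff Z A → |empFreq s A - p.real A| ≤ ε + D * (2 * δ) := by
  classical
  obtain ⟨φ, hφ, hcell⟩ := exists_monotone_grid p hδ hatom hN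
  have hφm : Measurable φ := hφ.measurable
  let ι := (Fin D → Fin N) × (Fin (D + 1) → Bool) × Bool
  let B : ι → Set ℝ := fun i =>
    if i.2.2 then φ ⁻¹' (gapUnion i.1 i.2.1 ∪ range i.1) else (φ ⁻¹' gapUnion i.1 i.2.1)ᶜ
  have hpre : ∀ S : Set (Fin N), MeasurableSet (φ ⁻¹' S) := fun S => hφm S.toFinite.measurableSet
  have hB : ∀ i, MeasurableSet (B i) := fun i => by
    by_cases h : i.2.2 <;> simp only [B, h]
    · exact hpre _
    · exact (hpre _).compl
  let bad : Set (Fin m → ℝ) := ⋃ i, {s | p.real (B i) + ε ≤ empFreq s (B i)}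
  have hbadm : MeasurableSet bad := MeasurableSet.iUnion fun i =>
    measurableSet_le measurable_const (measurable_empFreq (hB i))
  have hcard : (Fintype.card ι : ℝ) = (N : ℝ) ^ D * 2 ^ (D + 2) := by
    simp only [ι, Fintype.card_prod, Fintype.card_fun, Fintype.card_fin, Fintype.card_bool]
    push_cast
    ring
  have hbad : (samples p m).real bad ≤ 1 / 10 := by
    calc (samples p m).real bad
        ≤ ∑ i, (samples p m).real {s | p.real (B i) + ε ≤ empFreq s (B i)} :=
          measureReal_iUnion_fintype_le _
      _ ≤ ∑ _i : ι, Real.exp (-2 * m * ε ^ 2) :=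
          Finset.sum_le_sum fun i _ => samples_real_empFreq_ge_le p hm (hB i) hε
      _ = (N : ℝ) ^ D * 2 ^ (D + 2) * Real.exp (-2 * m * ε ^ 2) := by
          rw [Finset.sum_const, Finset.card_univ, nsmul_eq_mul, hcard]
      _ ≤ 1 / 10 := hbound
  refine ⟨badᶜ, ?_, fun s hs A Z hA => ?_⟩
  · have h1 : 9 / 10 ≤ (samples p m).real badᶜ := by
      rw [probReal_compl_eq_one_sub hbadm]
      linarith
    have h2 : (9 / 10 : ℝ≥0∞) = ENNReal.ofReal (9 / 10) := by
      rw [ENNReal.ofReal_div_of_pos (by norm_num)]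
      norm_num
    rw [h2]
    exact ENNReal.ofReal_le_of_le_toReal h1
  · obtain ⟨σ, hlo, hhi⟩ := hA.exists_gapUnion hφ
    have hgood : ∀ i, empFreq s (B i) < p.real (B i) + ε := fun i =>
      not_le.1 fun h => hs (mem_iUnion.2 ⟨i, h⟩)
    have g1 := hgood (φ ∘ Z, σ, true)
    have g2 := hgood (φ ∘ Z, σ, false)
    simp only [B, if_true, Bool.false_eq_true, if_false] at g1 g2
    rw [empFreq_compl hm, probReal_compl_eq_one_sub (hpre _)] at g2
    have hrange : p.real (φ ⁻¹' range (φ ∘ Z)) ≤ D * (2 * δ) := by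
      have : φ ⁻¹' range (φ ∘ Z) = ⋃ l, φ ⁻¹' {(φ ∘ Z) l} := by
        ext x
        simp [eq_comm]
      rw [this]
      refine (measureReal_iUnion_fintype_le _).trans ?_
      refine (Finset.sum_le_sum fun l _ => hcell _).trans ?_
      simp
    have hunion : p.real (φ ⁻¹' (gapUnion (φ ∘ Z) σ ∪ range (φ ∘ Z))) ≤
        p.real (φ ⁻¹' gapUnion (φ ∘ Z) σ) + p.real (φ ⁻¹' range (φ ∘ Z)) := by
      rw [preimage_union]
      exact measureReal_union_le _ _
    have m1 := empFreq_mono s hlo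
    have m2 := empFreq_mono s hhi
    have m3 : p.real (φ ⁻¹' gapUnion (φ ∘ Z) σ) ≤ p.real A := measureReal_mono hlo
    have m4 := measureReal_mono (μ := p) hhi
    rw [abs_le]
    constructor <;> linarith

end UniformDeviation

section PiecewisePolyDist

lemma IsPiecewisePolyDist.absolutelyContinuous {q : Measure ℝ} {a b : ℝ} {t d : ℕ}
    (h : IsPiecewisePolyDist q a b t d) : q ≪ volume := by
  obtain ⟨-, f, -, rfl, -⟩ := h
  exact (withDensity_absolutelyContinuous _ _).trans Measure.restrict_le_self.absolutelyContinuous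

lemma exists_isPiecewisePolyDist {n : ℕ} (hn : 1 ≤ n) (d : ℕ) :
    ∃ q, IsPiecewisePolyDist q (-1) 1 n d := by
  refine ⟨_, ⟨?_⟩, fun _ => 1 / 2, fun _ _ => by norm_num, rfl, ?_⟩
  · rw [withDensity_const, Measure.smul_apply, Measure.restrict_apply_univ, Real.volume_Ico,
      smul_eq_mul, ← ENNReal.ofReal_mul (by norm_num)]
    norm_num
  · refine IsPolyOff.isPiecewisePoly (B := ∅) (by norm_num) (fun u v _ _ _ _ => ?_)
      (by simpa using hn)
    exact ⟨Polynomial.C (1 / 2), by simp, fun y _ => by simp⟩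

lemma IsPiecewisePolyDist.sum {k t d n : ℕ} {a b : ℝ} (hab : a ≤ b) (hn : k * (t - 1) + 1 ≤ n)
    {μ : Fin k → ℝ≥0∞} (hμ : ∑ j, μ j = 1) {q : Fin k → Measure ℝ}
    (hq : ∀ j, IsPiecewisePolyDist (q j) a b t d) :
    IsPiecewisePolyDist (∑ j, μ j • q j) a b n d := by
  choose hprob f hf0 hfd hfp using hq
  have hfin : ∀ j, μ j ≠ ∞ := fun j hj => by
    have : μ j ≤ 1 := hμ ▸ Finset.single_le_sum (fun _ _ => zero_le) (Finset.mem_univ j)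
    simp [hj] at this
  refine ⟨⟨?_⟩, fun y => ∑ j, (μ j).toReal * f j y, fun y hy =>
    Finset.sum_nonneg fun j _ => mul_nonneg ENNReal.toReal_nonneg (hf0 j y hy), ?_,
    IsPiecewisePoly.sum hab hn _ hfp⟩
  · simp [Measure.finsetSum_apply, hμ]
  · ext S hS
    have hmeas : ∀ j, AEMeasurable (fun y => μ j * ENNReal.ofReal (f j y))
        ((volume.restrict (Ico a b)).restrict S) := fun j =>
      ((hfp j).aemeasurable.ennreal_ofReal.const_mul _).restrict
    have hcong : ∫⁻ y in S, ENNReal.ofReal (∑ j, (μ j).toReal * f j y)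
          ∂(volume.restrict (Ico a b)) =
        ∫⁻ y in S, ∑ j, μ j * ENNReal.ofReal (f j y) ∂(volume.restrict (Ico a b)) := by
      refine lintegral_congr_ae (ae_restrict_of_ae ?_)
      filter_upwards [ae_restrict_mem measurableSet_Ico] with y hy
      rw [ENNReal.ofReal_sum_of_nonneg fun j _ =>
        mul_nonneg ENNReal.toReal_nonneg (hf0 j y hy)]
      refine Finset.sum_congr rfl fun j _ => ?_
      rw [ENNReal.ofReal_mul ENNReal.toReal_nonneg, ENNReal.ofReal_toReal (hfin j)]
    rw [withDensity_apply _ hS, hcong, lintegral_finsetSum' _ fun j _ => hmeas j,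
      Measure.finsetSum_apply]
    refine Finset.sum_congr rfl fun j _ => ?_
    rw [lintegral_const_mul' _ _ (hfin j), Measure.smul_apply, smul_eq_mul,
      ← withDensity_apply _ hS, ← hfd j]

lemma IsPiecewisePolyDist.exists_yatracos_set {q q' : Measure ℝ} {a b : ℝ} {n d D : ℕ}
    (hab : a ≤ b) (hn : 1 ≤ n) (hD : 2 * n * (d + 1) ≤ D) (hq : IsPiecewisePolyDist q a b n d)
    (hq' : IsPiecewisePolyDist q' a b n d) :
    ∃ A : Set ℝ, MeasurableSet A ∧ (∃ Z : Fin D → ℝ, ConstantOff Z A) ∧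
      tvDist q q' ≤ q.real A - q'.real A := by
  obtain ⟨hprob, f, -, hfd, hfp⟩ := hq
  obtain ⟨hprob', f', -, hfd', hfp'⟩ := hq'
  have hsub := hfp.sub hab hn hfp'
  have hcomp : ∀ {g g' : ℝ → ℝ} {S : Set ℝ}, MeasurableSet S →
      (∀ y ∈ S, y ∈ Ico a b → g y ≤ g' y) →
      (volume.restrict (Ico a b)).withDensity (fun y => ENNReal.ofReal (g y)) S ≤
        (volume.restrict (Ico a b)).withDensity (fun y => ENNReal.ofReal (g' y)) S := by
    intro g g' S hS hg
    rw [withDensity_apply _ hS, withDensity_apply _ hS]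
    refine lintegral_mono_ae ?_
    filter_upwards [ae_restrict_mem hS, ae_restrict_of_ae (ae_restrict_mem measurableSet_Ico)]
      with y hy hyI using ENNReal.ofReal_le_ofReal (hg y hy hyI)
  refine ⟨_, hsub.measurableSet_pos, hsub.exists_constantOff ?_,
    tvDist_le_of_dominates hsub.measurableSet_pos ?_ ?_⟩
  · rwa [Nat.sub_add_cancel (by omega)]
  · intro S hS hSA
    rw [hfd, hfd']
    exact hcomp hS fun y hy _ => (sub_pos.1 (hSA hy).2).le
  · intro S hS hSA
    rw [hfd, hfd']
    exact hcomp hS fun y hy hyI => not_lt.1 fun h => hSA hy ⟨hyI, sub_pos.2 h⟩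

end PiecewisePolyDist

section MinimumDistance

/-- The minimum distance estimator over a sequence of candidates `u` with Yatracos sets `A i j`:
on every sample whose empirical frequencies are `η`-accurate on the sets `A i j`, it returns a
candidate within `3 * r + 2 * η` of `p`, if some candidate is within `r` of `p`. -/
lemma exists_minimum_distance_estimator (m : ℕ) {u : ℕ → Measure ℝ}
    (hu : ∀ n, IsProbabilityMeasure (u n)) {A : ℕ → ℕ → Set ℝ} (hA : ∀ i j, MeasurableSet (A i j))
    (hdist : ∀ i j, tvDist (u i) (u j) ≤ (u i).real (A i j) - (u j).real (A i j)) (r η : ℝ) :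
    ∃ E : (Fin m → ℝ) → Measure ℝ, Measurable E ∧ (∀ s, ∃ n, E s = u n) ∧
      ∀ (p : Measure ℝ), IsProbabilityMeasure p → ∀ s,
        (∀ i j, |empFreq s (A i j) - p.real (A i j)| ≤ η) →
        (∃ n, tvDist p (u n) ≤ r) → tvDist p (E s) ≤ 3 * r + 2 * η := by
  classical
  let good : ℕ → (Fin m → ℝ) → Prop := fun n s =>
    ∀ i j, |(u n).real (A i j) - empFreq s (A i j)| ≤ r + η
  have hgood : ∀ n, MeasurableSet {s | good n s} := fun n => by
    simp only [good, ofPred_forall]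
    exact MeasurableSet.iInter fun i => MeasurableSet.iInter fun j =>
      measurableSet_le (measurable_const.sub (measurable_empFreq (hA i j))).abs measurable_const
  have hex : ∀ s, ∃ n, good n s ∨ ∀ n', ¬ good n' s := fun s => by
    by_cases h : ∃ n, good n s
    · exact ⟨h.choose, Or.inl h.choose_spec⟩
    · exact ⟨0, Or.inr (not_exists.1 h)⟩
  refine ⟨fun s => u (Nat.find (hex s)), ?_, fun s => ⟨_, rfl⟩, ?_⟩
  · refine Measurable.find (f := fun n _ => u n) (fun n => measurable_const) (fun n => ?_) hex
    have : {s | ∀ n', ¬ good n' s} = ⋂ n', {s | good n' s}ᶜ := by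
      ext s
      simp
    refine (hgood n).union (s₂ := {s | ∀ n', ¬ good n' s}) ?_
    rw [this]
    exact MeasurableSet.iInter fun n' => (hgood n').compl
  · rintro p hp s hs ⟨n₀, hn₀⟩
    have h₀ : good n₀ s := fun i j => by
      have h1 := abs_le.1 ((abs_sub_le_tvDist p (u n₀) (hA i j)).trans hn₀)
      have h2 := abs_le.1 (hs i j)
      rw [abs_le]
      constructor <;> linarith [h1.1, h1.2, h2.1, h2.2]
    have hn : good (Nat.find (hex s)) s := (Nat.find_spec (hex s)).resolve_right fun h => h n₀ h₀
    set n := Nat.find (hex s)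
    have h1 := abs_le.1 (hn n₀ n)
    have h2 := abs_le.1 (h₀ n₀ n)
    have h3 := hdist n₀ n
    have h4 := tvDist_triangle p (u n₀) (u n)
    linarith [h1.1, h1.2, h2.1, h2.2]

end MinimumDistance

/-- A sample of this size makes the union bound over all gap unions at most `1 / 10`. -/
lemma pow_mul_exp_le_of_sample_size {K N m : ℕ} (hK : 1 ≤ K) {ε : ℝ} (hε : 0 < ε)
    (hε2 : ε < 1 / 2) (hN : (N : ℝ) ≤ 64 * K / ε + 1)
    (hm : 30 * K * Real.log (K / ε) / ε ^ 2 ≤ m) :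
    (N : ℝ) ^ (4 * K) * 2 ^ (4 * K + 2) * Real.exp (-2 * m * ε ^ 2) ≤ 1 / 10 := by
  have hK' : (1 : ℝ) ≤ K := by exact_mod_cast hK
  have hR : 2 ≤ K / ε := by
    rw [le_div_iff₀ hε]
    linarith
  set R := K / ε with hRdef
  have hNR : (N : ℝ) ≤ R ^ 8 := by
    have h1 : (N : ℝ) ≤ 2 ^ 7 * R := by
      rw [mul_div_assoc] at hN
      linarith
    have h2 : (2 : ℝ) ^ 7 ≤ R ^ 7 := pow_le_pow_left₀ (by norm_num) hR 7
    calc (N : ℝ) ≤ 2 ^ 7 * R := h1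
      _ ≤ R ^ 7 * R := by gcongr
      _ = R ^ 8 := by ring
  have hexp : Real.exp (-2 * m * ε ^ 2) ≤ (R ^ (60 * K))⁻¹ := by
    rw [← Real.exp_log (show 0 < R by linarith), ← Real.exp_nat_mul, ← Real.exp_neg,
      Real.exp_le_exp]
    rw [div_le_iff₀ (by positivity)] at hm
    push_cast
    linarith
  have hcount : (N : ℝ) ^ (4 * K) * 2 ^ (4 * K + 2) * 10 ≤ R ^ (60 * K) := by
    calc (N : ℝ) ^ (4 * K) * 2 ^ (4 * K + 2) * 10
        ≤ (R ^ 8) ^ (4 * K) * 2 ^ (4 * K + 2) * 2 ^ 4 := by gcongr; norm_num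
      _ ≤ (R ^ 8) ^ (4 * K) * R ^ (4 * K + 2) * R ^ 4 := by gcongr
      _ = R ^ (36 * K + 6) := by ring
      _ ≤ R ^ (60 * K) := pow_le_pow_right₀ (by linarith) (by omega)
  have hRpos : 0 < R ^ (60 * K) := by positivity
  calc (N : ℝ) ^ (4 * K) * 2 ^ (4 * K + 2) * Real.exp (-2 * m * ε ^ 2)
      ≤ (N : ℝ) ^ (4 * K) * 2 ^ (4 * K + 2) * (R ^ (60 * K))⁻¹ := by gcongr
    _ ≤ 1 / 10 := by
        rw [← div_eq_mul_inv, div_le_iff₀ hRpos]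
        linarith

/-- Theorem thm:learn-wb-mix: learning k-mixtures of (τ,t)-piecewise degree-d
distributions under a well-behavedness assumption. -/
theorem learn_wb_mixture :
    ∃ C c : ℝ, 0 < C ∧ 0 < c ∧
      ∀ k t d : ℕ, 1 ≤ k → 1 ≤ t →
      ∀ ε τ : ℝ, 0 < ε → ε < 1 → 0 ≤ τ →
        ∃ (m : ℕ) (A : (Fin m → ℝ) → Measure ℝ),
          (m : ℝ) ≤ C * ((d : ℝ) + 1) * k * t *
              (Real.log (((d : ℝ) + 1) * k * t / ε)) ^ c / ε ^ 2 ∧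
          Measurable A ∧
          ∀ p : Measure ℝ, IsProbabilityMeasure p → p (Set.Ico (-1 : ℝ) 1) = 1 →
            (∀ x : ℝ, p {x} ≤ ENNReal.ofReal (ε / (64 * (k : ℝ) * t * ((d : ℝ) + 1)))) →
            (∃ (μ : Fin k → ℝ≥0∞) (pc : Fin k → Measure ℝ),
              (∑ j, μ j) = 1 ∧ p = ∑ j, μ j • pc j ∧
              ∀ j, IsProbabilityMeasure (pc j) ∧ pc j (Set.Ico (-1 : ℝ) 1) = 1 ∧
                ∃ q : Measure ℝ, IsPiecewisePolyDist q (-1) 1 t d ∧ tvDist (pc j) q ≤ τ) →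
            (9 / 10 : ℝ≥0∞) ≤ samples p m
              {s | IsPiecewisePolyDist (A s) (-1) 1 (2 * k * t - 1) d ∧
                   tvDist p (A s) ≤ 3 * τ * (1 + ε) + C * ε} := by
  refine ⟨40, 1, by norm_num, by norm_num, fun k t d hk ht ε τ hε hε1 hτ => ?_⟩
  have hkt : 1 ≤ k * t := Nat.mul_pos hk ht
  have hkt' : 2 * k * t = 2 * (k * t) := by ring
  have hpieces : 1 ≤ 2 * k * t - 1 := by omega
  have hK : 1 ≤ (d + 1) * k * t := by rw [mul_assoc]; exact Nat.mul_pos d.succ_pos hkt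
  have hKcast : ((d : ℝ) + 1) * k * t = (((d + 1) * k * t : ℕ) : ℝ) := by push_cast; ring
  rw [hKcast, Real.rpow_one]
  have hscale : 40 * ((d : ℝ) + 1) * k * t = 40 * (((d + 1) * k * t : ℕ) : ℝ) := by
    push_cast; ring
  have hatoms : 64 * (k : ℝ) * t * ((d : ℝ) + 1) = 64 * (((d + 1) * k * t : ℕ) : ℝ) := by
    push_cast; ring
  rw [hscale, hatoms]
  set K := (d + 1) * k * t with hKdef
  have hK' : (1 : ℝ) ≤ K := by exact_mod_cast hK
  obtain ⟨q₀, hq₀⟩ := exists_isPiecewisePolyDist hpieces d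
  rcases le_or_gt (1 / 2) ε with hε2 | hε2
  · refine ⟨0, fun _ => q₀, ?_, measurable_const, fun p hp _ _ _ => ?_⟩
    · have : 0 ≤ Real.log (K / ε) := Real.log_nonneg (by rw [le_div_iff₀ hε]; linarith)
      rw [Nat.cast_zero]
      positivity
    · have := hq₀.1
      have hle : tvDist p q₀ ≤ 3 * τ * (1 + ε) + 40 * ε := by
        have : 0 ≤ 3 * τ * (1 + ε) := by positivity
        linarith [tvDist_le_one p q₀]
      simp only [hq₀, hle, and_self]
      rw [ofPred_true, measure_univ]
      exact ENNReal.div_le_of_le_mul (by norm_num)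
  have hL : 1 / 2 ≤ Real.log (K / ε) := by
    have h1 : (2 : ℝ) ≤ K / ε := by rw [le_div_iff₀ hε]; linarith
    have h2 := Real.log_le_log (by norm_num) h1
    linarith [Real.log_two_gt_d9]
  have hsize : 2 ≤ K * Real.log (K / ε) / ε ^ 2 := by
    rw [le_div_iff₀ (by positivity)]
    nlinarith
  set m := ⌈30 * K * Real.log (K / ε) / ε ^ 2⌉₊ with hmdef
  have hm_ge : 30 * K * Real.log (K / ε) / ε ^ 2 ≤ m := Nat.le_ceil _
  have hmul : ∀ c : ℝ, c * K * Real.log (K / ε) / ε ^ 2 = c * (K * Real.log (K / ε) / ε ^ 2) :=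
    fun c => by ring
  have hm_le : (m : ℝ) ≤ 40 * K * Real.log (K / ε) / ε ^ 2 := by
    have := Nat.ceil_lt_add_one (a := 30 * K * Real.log (K / ε) / ε ^ 2)
      (by rw [hmul]; linarith)
    rw [← hmdef, hmul] at this
    rw [hmul]
    linarith
  have hm_pos : 0 < m := by
    rw [hmul] at hm_ge
    have : (0 : ℝ) < m := by linarith
    exact_mod_cast this
  obtain ⟨u, huF, hu⟩ := exists_seq_tvDist_lt
    (F := {q | IsPiecewisePolyDist q (-1) 1 (2 * k * t - 1) d}) ⟨q₀, hq₀⟩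
    (fun q hq => ⟨hq.1, hq.absolutelyContinuous⟩) hε
  have hD : 2 * (2 * k * t - 1) * (d + 1) ≤ 4 * K := by
    have h1 : 2 * (2 * k * t - 1) ≤ 4 * (k * t) := by omega
    calc 2 * (2 * k * t - 1) * (d + 1) ≤ 4 * (k * t) * (d + 1) := Nat.mul_le_mul_right _ h1
      _ = 4 * K := by rw [hKdef]; ring
  choose A hAm hAZ hAd using fun i j =>
    (huF i).exists_yatracos_set (by norm_num) hpieces hD (huF j)
  obtain ⟨E, hEm, hEu, hE⟩ := exists_minimum_distance_estimator m (fun n => (huF n).1) hAm hAd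
    (τ + ε) (2 * ε)
  refine ⟨m, E, hm_le, hEm, fun p hp _ hatom ⟨μ, pc, hμ, hpμ, hpc⟩ => ?_⟩
  choose hpc1 _ q hq hpq using hpc
  have hδ : 0 < ε / (64 * (K : ℝ)) := by positivity
  have hinv : 1 / (ε / (64 * (K : ℝ))) = 64 * K / ε := one_div_div _ _
  obtain ⟨G, hG, hGdev⟩ := exists_uniform_deviation p hδ hatom
    (N := ⌊64 * K / ε⌋₊ + 1) (D := 4 * K) (m := m)
    (by rw [hinv]; exact_mod_cast Nat.lt_floor_add_one (64 * K / ε)) hm_pos hε.le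
    (pow_mul_exp_le_of_sample_size hK hε hε2
      (by push_cast; linarith [Nat.floor_le (show 0 ≤ 64 * K / ε by positivity)]) hm_ge)
  refine hG.trans (measure_mono fun s hs => ?_)
  obtain ⟨n, hn⟩ := hEu s
  refine ⟨hn ▸ huF n, ?_⟩
  have hslack : ε + (4 * K : ℕ) * (2 * (ε / (64 * (K : ℝ)))) ≤ 2 * ε := by
    have : ((4 * K : ℕ) : ℝ) * (2 * (ε / (64 * (K : ℝ)))) = ε / 8 := by
      push_cast
      field_simp
      norm_num
    linarith
  have hdev : ∀ i j, |empFreq s (A i j) - p.real (A i j)| ≤ 2 * ε := fun i j => by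
    obtain ⟨Z, hZ⟩ := hAZ i j
    exact (hGdev s hs _ Z hZ).trans hslack
  have hbreaks : k * (t - 1) + 1 ≤ 2 * k * t - 1 := by
    have : k * (t - 1) + k = k * t := by
      rw [← Nat.mul_succ, Nat.succ_eq_add_one, Nat.sub_add_cancel ht]
    omega
  have hqmix := IsPiecewisePolyDist.sum (by norm_num) hbreaks hμ hq
  obtain ⟨n₀, hn₀⟩ := hu _ hqmix
  have hclose : tvDist p (u n₀) ≤ τ + ε := by
    have := hqmix.1
    have := (huF n₀).1
    have h1 : tvDist p (∑ j, μ j • q j) ≤ τ :=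
      hpμ ▸ tvDist_sum_le hμ hpc1 (fun j => (hq j).1) hpq
    exact (tvDist_triangle p _ (u n₀)).trans (add_le_add h1 hn₀)
  have hfinal := hE p hp s hdev ⟨n₀, hclose⟩
  have : 0 ≤ τ * ε := by positivity
  linarith
end

section
/- There exist universal constants C, c > 0 such that the following holds. Let f : I → ℝ≥0 be any log-concave probability density, where I = [a,b] is an arbitrary (possibly infinite) interval, and let ε ∈ (0, 1/2). Then there exists an integer t ≤ C·ε^{−1/2}·(log(1/ε))^c and a t-piecewise degree-1 (piecewise linear) probability distribution g over I such that d_TV(f, g) ≤ ε; i.e., f admits an (ε,t)-piecewise linear decomposition with t = Õ(1/√ε). (Lemma lem:lc-struct.) -/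
open MeasureTheory Set

/-- f is a t-piecewise degree-d function on I: I is partitioned into t disjoint
intervals, on each of which f agrees with a polynomial of degree at most d. -/
def IsPiecewisePolyOn (I : Set ℝ) (t d : ℕ) (f : ℝ → ℝ) : Prop :=
  ∃ c : Fin t → Set ℝ, (∀ i, (c i).OrdConnected) ∧
    Pairwise (Function.onFun Disjoint c) ∧ I = ⋃ i, c i ∧
    ∀ i, ∃ P : Polynomial ℝ, P.natDegree ≤ d ∧ ∀ y ∈ c i, f y = P.eval y

/-- f is a log-concave probability density supported inside the interval I:
f = exp(g) on its (convex) support for some concave g. -/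
def IsLogConcaveDensityOn (I : Set ℝ) (f : ℝ → ℝ) : Prop :=
  (∀ x, 0 ≤ f x) ∧ (∀ x ∉ I, f x = 0) ∧ IntegrableOn f I ∧ (∫ x in I, f x) = 1 ∧
  ∃ S : Set ℝ, S ⊆ I ∧ Convex ℝ S ∧ (∀ x ∉ S, f x = 0) ∧
    ∃ g : ℝ → ℝ, ConcaveOn ℝ S g ∧ ∀ x ∈ S, f x = Real.exp (g x)

/-- `f` is approximated on `A`, with `L¹` error at most `e`, by a nonnegative integrable function
which is piecewise affine with `t` pieces. -/
def PiecewiseAffineApprox (f : ℝ → ℝ) (A : Set ℝ) (t : ℕ) (e : ℝ) : Prop :=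
  ∃ g : ℝ → ℝ, IsPiecewisePolyOn A t 1 g ∧ (∀ x ∈ A, 0 ≤ g x) ∧ IntegrableOn g A ∧
    ∫ x in A, |f x - g x| ≤ e

namespace PiecewiseAffineApprox

variable {f : ℝ → ℝ} {A B : Set ℝ} {s t : ℕ} {d e : ℝ}

lemma mono_error (h : PiecewiseAffineApprox f A t d) (hde : d ≤ e) :
    PiecewiseAffineApprox f A t e := by
  obtain ⟨g, h1, h2, h3, h4⟩ := h
  exact ⟨g, h1, h2, h3, h4.trans hde⟩

lemma union (hf : Integrable f) (hA : MeasurableSet A) (hB : MeasurableSet B)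
    (hAB : Disjoint A B) (h₁ : PiecewiseAffineApprox f A s d)
    (h₂ : PiecewiseAffineApprox f B t e) :
    PiecewiseAffineApprox f (A ∪ B) (s + t) (d + e) := by
  classical
  obtain ⟨g, ⟨c, hc, hcd, hcA, hcP⟩, hg0, hgi, hge⟩ := h₁
  obtain ⟨k, ⟨c', hc', hcd', hcB, hcP'⟩, hk0, hki, hke⟩ := h₂
  have hnA : ∀ x ∈ B, x ∉ A := fun x hx hx' => hAB.le_bot ⟨hx', hx⟩
  have hcsub : ∀ i, c i ⊆ A := fun i => hcA ▸ subset_iUnion c i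
  have hcsub' : ∀ i, c' i ⊆ B := fun i => hcB ▸ subset_iUnion c' i
  have eqA : EqOn (A.piecewise g k) g A := fun x hx => by simp [hx]
  have eqB : EqOn (A.piecewise g k) k B := fun x hx => by simp [hnA x hx]
  refine ⟨A.piecewise g k, ⟨Fin.append c c', ?_, ?_, ?_, ?_⟩, ?_, ?_, ?_⟩
  · intro i
    refine Fin.addCases (fun i => ?_) (fun i => ?_) i
    · simpa using hc i
    · simpa using hc' i
  · intro i j
    refine Fin.addCases (fun i => ?_) (fun i => ?_) i <;>
      refine Fin.addCases (fun j => ?_) (fun j => ?_) j <;> intro hij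
    · simpa [Function.onFun] using hcd (fun h => hij (by rw [h]))
    · simpa [Function.onFun] using hAB.mono (hcsub i) (hcsub' j)
    · simpa [Function.onFun] using hAB.symm.mono (hcsub' i) (hcsub j)
    · simpa [Function.onFun] using hcd' (fun h => hij (by rw [h]))
  · ext x
    constructor
    · rintro (hx | hx)
      · rw [hcA] at hx
        obtain ⟨i, hi⟩ := mem_iUnion.1 hx
        exact mem_iUnion.2 ⟨Fin.castAdd t i, by simpa using hi⟩
      · rw [hcB] at hx
        obtain ⟨i, hi⟩ := mem_iUnion.1 hx
        exact mem_iUnion.2 ⟨Fin.natAdd s i, by simpa using hi⟩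
    · intro hx
      obtain ⟨i, hi⟩ := mem_iUnion.1 hx
      revert hi
      refine Fin.addCases (fun i => ?_) (fun i => ?_) i <;> intro hi
      · exact Or.inl (hcsub i (by simpa using hi))
      · exact Or.inr (hcsub' i (by simpa using hi))
  · intro i
    refine Fin.addCases (fun i => ?_) (fun i => ?_) i
    · obtain ⟨P, hP, hPe⟩ := hcP i
      refine ⟨P, hP, fun y hy => ?_⟩
      rw [Fin.append_left] at hy
      rw [eqA (hcsub i hy), hPe y hy]
    · obtain ⟨P, hP, hPe⟩ := hcP' i
      refine ⟨P, hP, fun y hy => ?_⟩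
      rw [Fin.append_right] at hy
      rw [eqB (hcsub' i hy), hPe y hy]
  · rintro x (hx | hx)
    · rw [eqA hx]; exact hg0 x hx
    · rw [eqB hx]; exact hk0 x hx
  · exact (hgi.congr_fun eqA.symm hA).union (hki.congr_fun eqB.symm hB)
  · have h1 : IntegrableOn (fun x => |f x - A.piecewise g k x|) A :=
      IntegrableOn.congr_fun (hf.integrableOn.sub hgi).abs
        (fun x hx => by simp [eqA hx]) hA
    have h2 : IntegrableOn (fun x => |f x - A.piecewise g k x|) B :=
      IntegrableOn.congr_fun (hf.integrableOn.sub hki).abs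
        (fun x hx => by simp [eqB hx]) hB
    rw [setIntegral_union hAB hB h1 h2]
    refine add_le_add (le_trans (le_of_eq ?_) hge) (le_trans (le_of_eq ?_) hke)
    · exact setIntegral_congr_fun hA fun x hx => by simp only [eqA hx]
    · exact setIntegral_congr_fun hB fun x hx => by simp only [eqB hx]

lemma zero (hA : A.OrdConnected) (h : ∫ x in A, |f x| ≤ e) :
    PiecewiseAffineApprox f A 1 e := by
  refine ⟨fun _ => 0, ⟨fun _ => A, fun _ => hA, fun i j hij => (hij (Subsingleton.elim i j)).elim,
    (iUnion_const A).symm, fun _ => ⟨0, by simp, by simp⟩⟩, by simp, by simp, by simpa using h⟩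

lemma empty : PiecewiseAffineApprox f ∅ 0 0 :=
  ⟨fun _ => 0, ⟨fun _ => ∅, fun i => i.elim0, fun i => i.elim0, by simp, fun i => i.elim0⟩,
    by simp, by simp, by simp⟩

lemma affine_Ioc (hf : Integrable f) {u v α β : ℝ} (huv : u ≤ v)
    (hpos : ∀ x ∈ Ioc u v, 0 ≤ α + β * x) (herr : ∀ x ∈ Ioc u v, |f x - (α + β * x)| ≤ e) :
    PiecewiseAffineApprox f (Ioc u v) 1 (e * (v - u)) := by
  have hint : IntegrableOn (fun x => α + β * x) (Ioc u v) :=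
    (Continuous.integrableOn_Icc (by fun_prop)).mono_set Ioc_subset_Icc_self
  refine ⟨fun x => α + β * x, ⟨fun _ => Ioc u v, fun _ => ordConnected_Ioc,
    fun i j hij => (hij (Subsingleton.elim i j)).elim, (iUnion_const _).symm,
    fun _ => ⟨Polynomial.C β * Polynomial.X + Polynomial.C α, Polynomial.natDegree_linear_le,
      fun y _ => by simp [add_comm]⟩⟩, hpos, hint, ?_⟩
  calc ∫ x in Ioc u v, |f x - (α + β * x)| ≤ ∫ x in Ioc u v, e :=
        setIntegral_mono_on (hf.integrableOn.sub hint).abs (by simp) measurableSet_Ioc herr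
    _ = e * (v - u) := by simp [huv, mul_comm]

end PiecewiseAffineApprox

lemma abs_exp_sub_affine_le {a τ y H : ℝ} (hτ : |τ| ≤ 1) (hay : a + τ ≤ y) (ha : a ≤ H)
    (hy : y ≤ H) :
    |Real.exp y - Real.exp a * (1 + τ)| ≤ Real.exp H * ((y - (a + τ)) + τ ^ 2) := by
  have h1 : |Real.exp y - Real.exp (a + τ)| ≤ Real.exp H * (y - (a + τ)) := by
    rw [abs_of_nonneg (sub_nonneg.2 (Real.exp_le_exp.2 hay))]
    have h2 : Real.exp (a + τ) = Real.exp y * Real.exp ((a + τ) - y) := by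
      rw [← Real.exp_add]; congr 1; ring
    have h3 := Real.add_one_le_exp ((a + τ) - y)
    calc Real.exp y - Real.exp (a + τ) ≤ Real.exp y * (y - (a + τ)) := by
          rw [h2]; nlinarith [Real.exp_pos y]
      _ ≤ Real.exp H * (y - (a + τ)) :=
          mul_le_mul_of_nonneg_right (Real.exp_le_exp.2 hy) (by linarith)
  have h4 : |Real.exp (a + τ) - Real.exp a * (1 + τ)| ≤ Real.exp H * τ ^ 2 := by
    have h5 : Real.exp (a + τ) - Real.exp a * (1 + τ) = Real.exp a * (Real.exp τ - 1 - τ) := by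
      rw [Real.exp_add]; ring
    rw [h5, abs_mul, abs_of_pos (Real.exp_pos a)]
    exact mul_le_mul (Real.exp_le_exp.2 ha) (Real.abs_exp_sub_one_sub_id_le hτ) (abs_nonneg _)
      (Real.exp_pos H).le
  calc _ ≤ |Real.exp y - Real.exp (a + τ)| + |Real.exp (a + τ) - Real.exp a * (1 + τ)| :=
        abs_sub_le _ _ _
    _ ≤ _ := by linarith

/-- `f = exp h` on `A`, where `h` is concave with values in `[H - R, H]`. -/
structure IsLogConcaveBand (f h : ℝ → ℝ) (A : Set ℝ) (H R : ℝ) : Prop where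
  concave : ConcaveOn ℝ A h
  eq_exp : ∀ x ∈ A, f x = Real.exp (h x)
  lower : ∀ x ∈ A, H - R ≤ h x
  upper : ∀ x ∈ A, h x ≤ H

namespace IsLogConcaveBand

variable {f h : ℝ → ℝ} {A : Set ℝ} {H R : ℝ}

lemma mono (hb : IsLogConcaveBand f h A H R) {B : Set ℝ} (hBA : B ⊆ A) (hB : Convex ℝ B) :
    IsLogConcaveBand f h B H R :=
  ⟨hb.concave.subset hBA hB, fun x hx => hb.eq_exp x (hBA hx), fun x hx => hb.lower x (hBA hx),
    fun x hx => hb.upper x (hBA hx)⟩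

lemma exp_le (hb : IsLogConcaveBand f h A H R) {x : ℝ} (hx : x ∈ A) :
    |f x| ≤ Real.exp H := by
  rw [hb.eq_exp x hx, abs_of_pos (Real.exp_pos _)]
  exact Real.exp_le_exp.2 (hb.upper x hx)

/-- Secant slopes are bounded by the oscillation divided by the distance to the boundary. -/
lemma abs_slope_le (hb : IsLogConcaveBand f h A H R) {p q u v δ : ℝ} (hδ : 0 < δ)
    (hp : p ∈ A) (hq : q ∈ A) (hpu : p + δ ≤ u) (huv : u < v) (hvq : v + δ ≤ q) :
    |(h v - h u) / (v - u)| ≤ R / δ := by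
  have hA := hb.concave.1.ordConnected
  have hu : u ∈ A := hA.out hp hq ⟨by linarith, by linarith⟩
  have hv : v ∈ A := hA.out hp hq ⟨by linarith, by linarith⟩
  have hR : 0 ≤ R := by linarith [hb.lower p hp, hb.upper p hp]
  have h1 := hb.concave.slope_anti_adjacent hp hv (show p < u by linarith) huv
  have h2 := hb.concave.slope_anti_adjacent hu hq huv (show v < q by linarith)
  have h3 : (h u - h p) / (u - p) ≤ R / δ :=
    div_le_div₀ hR (by linarith [hb.lower p hp, hb.upper u hu]) hδ (by linarith)
  have h4 : (h v - h q) / (q - v) ≤ R / δ :=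
    div_le_div₀ hR (by linarith [hb.lower q hq, hb.upper v hv]) hδ (by linarith)
  have h5 : (h v - h q) / (q - v) = - ((h q - h v) / (q - v)) := by ring
  rw [abs_le]
  constructor <;> linarith

/-- One affine piece on `(u, v]`, with error controlled by the change of secant slope. -/
lemma piecewiseAffineApprox_Ioc (hb : IsLogConcaveBand f h A H R) (hf : Integrable f)
    {u' u v S : ℝ} (hu' : u' ∈ A) (hv : v ∈ A) (hu'u : u' < u) (huv : u < v)
    (hS : |(h v - h u) / (v - u)| ≤ S) (hSw : S * (v - u) ≤ 1) :
    PiecewiseAffineApprox f (Ioc u v) 1 (Real.exp H *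
      (((h u - h u') / (u - u') - (h v - h u) / (v - u)) * (v - u) + (S * (v - u)) ^ 2)
        * (v - u)) := by
  have hA := hb.concave.1.ordConnected
  have hu : u ∈ A := hA.out hu' hv ⟨by linarith, by linarith⟩
  set σ := (h v - h u) / (v - u) with hσ
  set s := (h u - h u') / (u - u') with hs
  have hwpos : 0 < v - u := by linarith
  have hsσ : σ ≤ s := hb.concave.slope_anti_adjacent hu' hv hu'u huv
  have hτ : ∀ x ∈ Ioc u v, |σ * (x - u)| ≤ S * (v - u) := by
    rintro x ⟨h1, h2⟩
    rw [abs_mul, abs_of_pos (by linarith : 0 < x - u)]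
    exact mul_le_mul hS (by linarith) (by linarith) ((abs_nonneg _).trans hS)
  refine PiecewiseAffineApprox.affine_Ioc (α := Real.exp (h u) * (1 - σ * u))
    (β := Real.exp (h u) * σ) hf huv.le ?_ ?_
  · intro x hx
    have h1 := (abs_le.1 ((hτ x hx).trans hSw)).1
    have h2 : Real.exp (h u) * (1 - σ * u) + Real.exp (h u) * σ * x
      = Real.exp (h u) * (1 + σ * (x - u)) := by ring
    rw [h2]
    exact mul_nonneg (Real.exp_pos _).le (by linarith)
  · intro x hx
    have hxA : x ∈ A := hA.out hu hv ⟨hx.1.le, hx.2⟩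
    have hxu : 0 < x - u := by linarith [hx.1]
    have h2 : Real.exp (h u) * (1 - σ * u) + Real.exp (h u) * σ * x
      = Real.exp (h u) * (1 + σ * (x - u)) := by ring
    have hupper : h x ≤ h u + s * (x - u) := by
      have := hb.concave.slope_anti_adjacent hu' hxA hu'u hx.1
      rw [div_le_iff₀ hxu] at this
      linarith
    have hlower : h u + σ * (x - u) ≤ h x := by
      rcases eq_or_lt_of_le hx.2 with rfl | hxv
      · rw [hσ, div_mul_cancel₀ _ hwpos.ne']; linarith
      · have := hb.concave.slope_anti_adjacent hu hv hx.1 hxv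
        rw [div_le_div_iff₀ (by linarith) hxu] at this
        have h3 : σ * (v - u) = h v - h u := div_mul_cancel₀ _ hwpos.ne'
        have h4 : (h u + σ * (x - u) - h x) * (v - u) ≤ 0 := by
          linear_combination this + (x - u) * h3
        nlinarith
    rw [h2, hb.eq_exp x hxA]
    refine (abs_exp_sub_affine_le ((hτ x hx).trans hSw) hlower (hb.upper u hu)
      (hb.upper x hxA)).trans ?_
    refine mul_le_mul_of_nonneg_left (add_le_add ?_ ?_) (Real.exp_pos H).le
    · have h5 : (s - σ) * (x - u) ≤ (s - σ) * (v - u) :=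
        mul_le_mul_of_nonneg_left (by linarith [hx.2]) (by linarith)
      linarith
    · exact sq_le_sq' (by linarith [(abs_le.1 (hτ x hx)).1]) (abs_le.1 (hτ x hx)).2

lemma piecewiseAffineApprox_uniform (hb : IsLogConcaveBand f h A H R) (hf : Integrable f)
    {p q p₀ w δ : ℝ} {n : ℕ} (hδ : 0 < δ) (hw : 0 < w) (hp : p ∈ A) (hq : q ∈ A)
    (hpp : p + δ + w ≤ p₀) (hqp : p₀ + n * w + δ ≤ q) (hRw : R / δ * w ≤ 1) :
    PiecewiseAffineApprox f (Ioc p₀ (p₀ + n * w)) n (Real.exp H *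
      (2 * (R / δ) * w ^ 2 + n * w * (R / δ * w) ^ 2)) := by
  set S := R / δ with hS
  let σ : ℕ → ℝ := fun i => (h (p₀ + i * w) - h (p₀ + i * w - w)) / w
  have hbd : ∀ i ≤ n, |σ i| ≤ S := by
    intro i hi
    have hi' : (i : ℝ) * w ≤ n * w := by gcongr
    have h0 : 0 ≤ (i : ℝ) * w := by positivity
    have := hb.abs_slope_le (u := p₀ + i * w - w) (v := p₀ + i * w) hδ hp hq (by linarith)
      (by linarith) (by linarith)
    simpa [σ] using this
  have key : ∀ m ≤ n, PiecewiseAffineApprox f (Ioc p₀ (p₀ + m * w)) m (Real.exp H *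
      ((σ 0 - σ m) * w ^ 2 + m * w * (S * w) ^ 2)) := by
    intro m
    induction m with
    | zero => intro _; simpa using PiecewiseAffineApprox.empty
    | succ m ih =>
      intro hm
      have hm' : ((m + 1 : ℕ) : ℝ) * w ≤ n * w := by gcongr
      have h0 : 0 ≤ (m : ℝ) * w := by positivity
      push_cast at hm'
      have hA := hb.concave.1.ordConnected
      have e1 : p₀ + m * w + w - (p₀ + m * w) = w := by ring
      have e2 : p₀ + m * w - (p₀ + m * w - w) = w := by ring
      have e3 : p₀ + ((m + 1 : ℕ) : ℝ) * w = p₀ + m * w + w := by push_cast; ring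
      have e4 : σ (m + 1) = (h (p₀ + m * w + w) - h (p₀ + m * w)) / w := by
        simp only [σ, e3]; congr 3; ring
      have := hb.piecewiseAffineApprox_Ioc hf (u' := p₀ + m * w - w) (u := p₀ + m * w)
        (v := p₀ + m * w + w) (S := S) (hA.out hp hq ⟨by linarith, by linarith⟩)
        (hA.out hp hq ⟨by linarith, by linarith⟩) (by linarith) (by linarith)
        (by rw [e1, ← e4]; exact hbd _ hm) (by rw [e1]; exact hRw)
      rw [e1, e2, ← e4] at this
      have hu := (ih (by omega)).union hf measurableSet_Ioc measurableSet_Ioc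
        (Set.disjoint_left.2 fun x hx hx' => not_lt.2 hx.2 hx'.1) this
      rw [Ioc_union_Ioc_eq_Ioc (by linarith) (by linarith), ← e3] at hu
      refine hu.mono_error (le_of_eq ?_)
      simp only [σ]
      push_cast
      ring
  refine (key n le_rfl).mono_error ?_
  have h1 := (abs_le.1 (hbd 0 (Nat.zero_le _))).2
  have h2 := (abs_le.1 (hbd n le_rfl)).1
  gcongr
  linarith

/-- On an interval `(p, p + r]` well inside the band, `n` equal pieces give error `O(n⁻²)`. -/
lemma piecewiseAffineApprox_block (hb : IsLogConcaveBand f h A H R) (hf : Integrable f)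
    {p r : ℝ} {n : ℕ} (hr : 0 < r) (hR : 1 ≤ R) (hn : 4 * R ≤ n)
    (hp : p - r / 2 ∈ A) (hq : p + 3 / 2 * r ∈ A) :
    PiecewiseAffineApprox f (Ioc p (p + r)) n (24 * Real.exp H * R ^ 2 / n ^ 2 * r) := by
  have hn0 : (0 : ℝ) < n := by linarith
  have e : (n : ℝ) * (r / n) = r := by field_simp
  have hw : r / n ≤ r / 4 := div_le_div_of_nonneg_left hr.le (by norm_num) (by linarith)
  have e2 : R / (r / 4) * (r / n) = 4 * R / n := by field_simp
  have := hb.piecewiseAffineApprox_uniform hf (δ := r / 4) (w := r / n) (p₀ := p) (n := n)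
    (by positivity) (by positivity) hp hq (by linarith) (by rw [e]; linarith)
    (by rw [e2, div_le_one hn0]; exact hn)
  rw [e, e2] at this
  refine this.mono_error ?_
  have e3 : Real.exp H * (2 * (R / (r / 4)) * (r / n) ^ 2 + r * (4 * R / n) ^ 2)
    = Real.exp H * r / n ^ 2 * (8 * R + 16 * R ^ 2) := by field_simp; ring
  have e4 : 24 * Real.exp H * R ^ 2 / n ^ 2 * r = Real.exp H * r / n ^ 2 * (24 * R ^ 2) := by ring
  rw [e3, e4]
  gcongr
  nlinarith

lemma piecewiseAffineApprox_left (hb : IsLogConcaveBand f h A H R) (hf : Integrable f)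
    {n : ℕ} (hR : 1 ≤ R) (hn : 4 * R ≤ n) {a : ℝ} (J : ℕ) :
    ∀ {r : ℝ}, 0 < r → Ioo a (a + 2 * r) ⊆ A →
    PiecewiseAffineApprox f (Ioc a (a + r)) (J * n + 1)
      (24 * Real.exp H * R ^ 2 / n ^ 2 * r + Real.exp H * r / 2 ^ J) := by
  have hn0 : (0 : ℝ) < n := by linarith
  induction J with
  | zero =>
    intro r hr hA
    rw [zero_mul, zero_add]
    refine PiecewiseAffineApprox.zero ordConnected_Ioc ?_
    have h1 : ∫ x in Ioc a (a + r), |f x| ≤ ∫ x in Ioc a (a + r), Real.exp H :=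
      setIntegral_mono_on hf.abs.integrableOn (by simp) measurableSet_Ioc
        fun x hx => hb.exp_le (hA ⟨hx.1, by linarith [hx.2]⟩)
    have h2 : ∫ x in Ioc a (a + r), Real.exp H = Real.exp H * r := by
      simp [hr.le, mul_comm]
    have h3 : 0 ≤ 24 * Real.exp H * R ^ 2 / n ^ 2 * r := by positivity
    simp only [pow_zero, div_one]
    linarith
  | succ J ih =>
    intro r hr hA
    have h1 := ih (r := r / 2) (by positivity)
      ((Ioo_subset_Ioo_right (by linarith)).trans hA)
    have h2 := hb.piecewiseAffineApprox_block hf (p := a + r / 2) (r := r / 2) (by positivity) hR hn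
      (hA ⟨by linarith, by linarith⟩) (hA ⟨by linarith, by linarith⟩)
    have h3 := h1.union hf measurableSet_Ioc measurableSet_Ioc
        (Set.disjoint_left.2 fun x hx hx' => not_lt.2 hx.2 hx'.1) h2
    rw [Ioc_union_Ioc_eq_Ioc (by linarith) (by linarith), add_assoc, add_halves] at h3
    have e1 : J * n + 1 + n = (J + 1) * n + 1 := by ring
    rw [e1] at h3
    refine h3.mono_error (le_of_eq ?_)
    rw [pow_succ]
    ring

lemma piecewiseAffineApprox_right (hb : IsLogConcaveBand f h A H R) (hf : Integrable f)
    {n : ℕ} (hR : 1 ≤ R) (hn : 4 * R ≤ n) {b : ℝ} (J : ℕ) :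
    ∀ {r : ℝ}, 0 < r → Ioo (b - 2 * r) b ⊆ A →
    PiecewiseAffineApprox f (Ioo (b - r) b) (J * n + 1)
      (24 * Real.exp H * R ^ 2 / n ^ 2 * r + Real.exp H * r / 2 ^ J) := by
  have hn0 : (0 : ℝ) < n := by linarith
  induction J with
  | zero =>
    intro r hr hA
    rw [zero_mul, zero_add]
    refine PiecewiseAffineApprox.zero ordConnected_Ioo ?_
    have h1 : ∫ x in Ioo (b - r) b, |f x| ≤ ∫ x in Ioo (b - r) b, Real.exp H :=
      setIntegral_mono_on hf.abs.integrableOn (by simp) measurableSet_Ioo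
        fun x hx => hb.exp_le (hA ⟨by linarith [hx.1], hx.2⟩)
    have h2 : ∫ x in Ioo (b - r) b, Real.exp H = Real.exp H * r := by
      simp [hr.le, mul_comm]
    have h3 : 0 ≤ 24 * Real.exp H * R ^ 2 / n ^ 2 * r := by positivity
    simp only [pow_zero, div_one]
    linarith
  | succ J ih =>
    intro r hr hA
    have h1 := ih (r := r / 2) (by positivity)
      ((Ioo_subset_Ioo_left (by linarith)).trans hA)
    have h2 := hb.piecewiseAffineApprox_block hf (p := b - r) (r := r / 2) (by positivity) hR hn
      (hA ⟨by linarith, by linarith⟩) (hA ⟨by linarith, by linarith⟩)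
    have e0 : b - r + r / 2 = b - r / 2 := by ring
    rw [e0] at h2
    have h3 := h1.union hf measurableSet_Ioo measurableSet_Ioc
        (Set.disjoint_left.2 fun x hx hx' => not_lt.2 hx'.2 hx.1) h2
    rw [union_comm, Ioc_union_Ioo_eq_Ioo (by linarith) (by linarith)] at h3
    have e1 : J * n + 1 + n = (J + 1) * n + 1 := by ring
    rw [e1] at h3
    refine h3.mono_error (le_of_eq ?_)
    rw [pow_succ]
    ring

lemma piecewiseAffineApprox_Ioo (hf : Integrable f) {a b : ℝ}
    (hb : IsLogConcaveBand f h (Ioo a b) H R)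
    {n : ℕ} (hR : 1 ≤ R) (hn : 4 * R ≤ n) (hab : a < b) (J : ℕ) :
    PiecewiseAffineApprox f (Ioo a b) (2 * (J * n + 1))
      (Real.exp H * (b - a) * (24 * R ^ 2 / n ^ 2 + 1 / 2 ^ J)) := by
  have h1 := hb.piecewiseAffineApprox_left hf hR hn (a := a) (r := (b - a) / 2) J (by linarith)
    (by rw [mul_div_cancel₀ _ two_ne_zero, add_sub_cancel])
  have h2 := hb.piecewiseAffineApprox_right hf hR hn (b := b) (r := (b - a) / 2) J (by linarith)
    (by rw [mul_div_cancel₀ _ two_ne_zero, sub_sub_cancel])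
  have e : b - (b - a) / 2 = a + (b - a) / 2 := by ring
  rw [e] at h2
  have h3 := h1.union hf measurableSet_Ioc measurableSet_Ioo
        (Set.disjoint_left.2 fun x hx hx' => not_lt.2 hx.2 hx'.1) h2
  rw [Ioc_union_Ioo_eq_Ioo (by linarith) (by linarith), ← two_mul] at h3
  exact h3.mono_error (le_of_eq (by ring))

end IsLogConcaveBand

/-- `f` is a probability density on `ℝ` equal to `exp g` on `S`, with `g` concave, and vanishing
outside `S`. -/
structure IsExpConcaveDensity (f g : ℝ → ℝ) (S : Set ℝ) : Prop where
  nonneg : ∀ x, 0 ≤ f x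
  integrable : Integrable f
  integral_eq_one : ∫ x, f x = 1
  eq_zero : ∀ x ∉ S, f x = 0
  concave : ConcaveOn ℝ S g
  eq_exp : ∀ x ∈ S, f x = Real.exp (g x)

lemma integrable_exp_neg_mul_abs {c : ℝ} (hc : 0 < c) (y : ℝ) :
    Integrable (fun x : ℝ => Real.exp (-c * |x - y|)) ∧
      ∫ x : ℝ, Real.exp (-c * |x - y|) = 2 / c := by
  have h1 : ∫ x : ℝ, Real.exp (-c * |x|) = 2 / c := by
    rw [integral_comp_abs (f := fun x => Real.exp (-c * x)),
      integral_exp_mul_Ioi (by linarith : -c < 0) 0]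
    simp
    ring
  have h2 : Integrable (fun x : ℝ => Real.exp (-c * |x|)) := by
    by_contra hcon
    rw [integral_undef hcon] at h1
    have : 0 < 2 / c := by positivity
    linarith
  exact ⟨h2.comp_sub_right y, by
    rw [integral_sub_right_eq_self (fun x : ℝ => Real.exp (-c * |x|)) y, h1]⟩

namespace IsExpConcaveDensity

variable {f g : ℝ → ℝ} {S : Set ℝ}

lemma exp_mul_abs_sub_le_one (hd : IsExpConcaveDensity f g S) {u v c : ℝ} (hu : u ∈ S)
    (hv : v ∈ S) (hcu : c ≤ g u) (hcv : c ≤ g v) : Real.exp c * |v - u| ≤ 1 := by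
  wlog huv : u ≤ v generalizing u v
  · rw [abs_sub_comm]
    exact this hv hu hcv hcu (le_of_not_ge huv)
  rw [abs_of_nonneg (by linarith)]
  have hle : ∀ x ∈ Icc u v, Real.exp c ≤ f x := by
    intro x hx
    have hxS : x ∈ S := hd.concave.1.ordConnected.out hu hv hx
    rw [hd.eq_exp x hxS]
    refine Real.exp_le_exp.2 (le_trans (le_min hcu hcv) ?_)
    exact hd.concave.min_le_of_mem_Icc hu hv hx
  have h1 : ∫ x in Icc u v, Real.exp c ≤ ∫ x in Icc u v, f x :=
    setIntegral_mono_on (by simp) hd.integrable.integrableOn measurableSet_Icc hle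
  have h2 : ∫ x in Icc u v, f x ≤ ∫ x, f x :=
    setIntegral_le_integral hd.integrable (Filter.Eventually.of_forall hd.nonneg)
  rw [hd.integral_eq_one] at h2
  have h3 : ∫ x in Icc u v, Real.exp c = Real.exp c * (v - u) := by simp [huv, mul_comm]
  linarith

lemma nontrivial (hd : IsExpConcaveDensity f g S) : S.Nontrivial := by
  by_contra hS
  rw [not_nontrivial_iff] at hS
  have h0 : f =ᵐ[volume] 0 := by
    have : volume S = 0 := hS.measure_zero _
    filter_upwards [measure_eq_zero_iff_ae_notMem.1 this] with x hx using hd.eq_zero x hx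
  have := integral_congr_ae h0
  rw [hd.integral_eq_one] at this
  simp at this

lemma le_midpoint (hd : IsExpConcaveDensity f g S) {x y : ℝ} (hx : x ∈ S) (hy : y ∈ S) :
    (x + y) / 2 ∈ S ∧ (g x + g y) / 2 ≤ g ((x + y) / 2) := by
  have e : (1 / 2 : ℝ) • x + (1 / 2 : ℝ) • y = (x + y) / 2 := by simp only [smul_eq_mul]; ring
  have h1 := hd.concave.1 hx hy (by norm_num : (0 : ℝ) ≤ 1 / 2) (by norm_num : (0 : ℝ) ≤ 1 / 2)
    (by norm_num)
  have h2 := hd.concave.2 hx hy (by norm_num : (0 : ℝ) ≤ 1 / 2) (by norm_num : (0 : ℝ) ≤ 1 / 2)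
    (by norm_num)
  rw [e] at h1 h2
  simp only [smul_eq_mul] at h2
  exact ⟨h1, by linarith⟩

lemma bddAbove (hd : IsExpConcaveDensity f g S) : BddAbove (g '' S) := by
  obtain ⟨x₀, h₀, x₁, h₁, hne⟩ := hd.nontrivial
  set m := min (g x₀) (g x₁) with hm
  have hdpos : 0 < |x₀ - x₁| := abs_pos.2 (sub_ne_zero.2 hne)
  refine ⟨max m (2 * Real.log (4 / |x₀ - x₁|) - m), ?_⟩
  rintro _ ⟨x, hx, rfl⟩
  rcases le_total (g x) m with hxm | hxm
  · exact hxm.trans (le_max_left _ _)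
  refine le_trans ?_ (le_max_right _ _)
  have key : ∀ y ∈ S, m ≤ g y → Real.exp ((g x + m) / 2) * |x - y| ≤ 2 := by
    intro y hy hmy
    obtain ⟨h2, h3⟩ := hd.le_midpoint hx hy
    have h4 := hd.exp_mul_abs_sub_le_one (c := (g x + m) / 2) h2 hx (by linarith) (by linarith)
    have e : x - (x + y) / 2 = (x - y) / 2 := by ring
    rw [e, abs_div, abs_of_pos (by norm_num : (0 : ℝ) < 2)] at h4
    linarith
  have k0 := key x₀ h₀ (min_le_left _ _)
  have k1 := key x₁ h₁ (min_le_right _ _)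
  have htri : |x₀ - x₁| ≤ |x - x₀| + |x - x₁| := by
    rw [abs_sub_comm x x₀]; exact abs_sub_le _ _ _
  have h5 : Real.exp ((g x + m) / 2) ≤ 4 / |x₀ - x₁| := by
    rw [le_div_iff₀ hdpos]
    nlinarith [Real.exp_pos ((g x + m) / 2)]
  have h6 := (Real.le_log_iff_exp_le (by positivity)).2 h5
  linarith

/-- A log-concave density decays exponentially away from a near-mode. -/
lemma exists_decay (hd : IsExpConcaveDensity f g S) :
    ∃ H y : ℝ, y ∈ S ∧ H - 1 / 2 < g y ∧ (∀ x ∈ S, g x ≤ H) ∧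
      ∀ x ∈ S, Real.exp H / (2 * Real.exp 1) * |x - y| ≤ H - g x + 1 := by
  have hne : (g '' S).Nonempty := hd.nontrivial.nonempty.image g
  set H := sSup (g '' S) with hH
  have hle : ∀ x ∈ S, g x ≤ H := fun x hx => le_csSup hd.bddAbove (mem_image_of_mem g hx)
  obtain ⟨_, ⟨y, hy, rfl⟩, hyH⟩ := exists_lt_of_lt_csSup hne (by linarith : H - 1 / 2 < H)
  have hexp : Real.exp H / (2 * Real.exp 1) = Real.exp (H - 1) / 2 := by
    rw [Real.exp_sub]; field_simp
  refine ⟨H, y, hy, hyH, hle, fun x hx => ?_⟩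
  have hxH := hle x hx
  rw [hexp]
  rcases le_total (H - g x) 1 with hs | hs
  · have := hd.exp_mul_abs_sub_le_one (c := H - 1) hy hx (by linarith) (by linarith)
    linarith
  · set s := H - g x with hs'
    have ht0 : 0 ≤ 1 / (2 * s) := by positivity
    have ht1 : 1 / (2 * s) ≤ 1 := by rw [div_le_one (by linarith)]; linarith
    have hts : 1 / (2 * s) * s = 1 / 2 := by field_simp
    have h1 := hd.concave.1 hy hx (sub_nonneg.2 ht1) ht0 (by ring)
    have h2 := hd.concave.2 hy hx (sub_nonneg.2 ht1) ht0 (by ring)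
    simp only [smul_eq_mul] at h1 h2
    set t := 1 / (2 * s) with ht
    have hz : H - 1 ≤ g ((1 - t) * y + t * x) := by
      have : (1 - t) * (H - 1 / 2) ≤ (1 - t) * g y :=
        mul_le_mul_of_nonneg_left hyH.le (by linarith)
      have h3 : g x = H - s := by rw [hs']; ring
      rw [h3] at h2
      nlinarith
    have h4 := hd.exp_mul_abs_sub_le_one (c := H - 1) hy h1 (by linarith) hz
    have e : (1 - t) * y + t * x - y = t * (x - y) := by ring
    rw [e, abs_mul, abs_of_nonneg ht0] at h4
    have h5 : Real.exp (H - 1) / 2 * |x - y| = s * (Real.exp (H - 1) * (t * |x - y|)) := by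
      have : s * (Real.exp (H - 1) * (t * |x - y|))
        = (t * s) * (Real.exp (H - 1) * |x - y|) := by ring
      rw [this, hts]; ring
    rw [h5]
    nlinarith

/-- Truncating a log-concave density at the level `exp (-R)` below its supremum leaves an interval
of length `O(R)` in units of the inverse supremum, up to exponentially small mass. -/
lemma exists_truncation (hd : IsExpConcaveDensity f g S) {R : ℝ} (hR : 1 ≤ R) :
    ∃ H a b : ℝ, a ≤ b ∧ Ioo a b ⊆ S ∧ IsLogConcaveBand f g (Ioo a b) H R ∧
      Real.exp H * (b - a) ≤ 8 * Real.exp 1 * R ∧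
      (∫ x in Iic a, |f x| ≤ 8 * Real.exp (3 / 2 - R / 2)) ∧
      ∫ x in Ici b, |f x| ≤ 8 * Real.exp (3 / 2 - R / 2) := by
  obtain ⟨H, y, hy, hyH, hle, hdec⟩ := hd.exists_decay
  set c := Real.exp H / (2 * Real.exp 1) with hc
  have hcpos : 0 < c := by positivity
  set A : Set ℝ := {x ∈ S | H - R ≤ g x} with hA
  have hAconv : Convex ℝ A := hd.concave.convex_ge (H - R)
  set F : ℝ → ℝ := fun x => Real.exp (H + 1 / 2 - R / 2) * Real.exp (-(c / 2) * |x - y|) with hF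
  have hFle : ∀ x ∉ A, |f x| ≤ F x := by
    intro x hx
    by_cases hxS : x ∈ S
    · have h1 : g x < H - R := by
        by_contra hcon
        exact hx ⟨hxS, not_lt.1 hcon⟩
      have h2 := hdec x hxS
      rw [hd.eq_exp x hxS, abs_of_pos (Real.exp_pos _), hF]
      simp only
      rw [← Real.exp_add]
      exact Real.exp_le_exp.2 (by linarith)
    · rw [hd.eq_zero x hxS, abs_zero]
      positivity
  obtain ⟨hi, hint⟩ := integrable_exp_neg_mul_abs (half_pos hcpos) y
  have hFi : Integrable F := hi.const_mul _
  have hFint : ∫ x, F x = 8 * Real.exp (3 / 2 - R / 2) := by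
    rw [hF, integral_const_mul, hint, hc]
    have : Real.exp (H + 1 / 2 - R / 2)
        = Real.exp H * Real.exp (3 / 2 - R / 2) / Real.exp 1 := by
      rw [← Real.exp_add, ← Real.exp_sub]; congr 1; ring
    rw [this]
    field_simp
    ring
  have hFset : ∀ B : Set ℝ, (∀ᵐ x ∂(volume.restrict B), x ∉ A) →
      ∫ x in B, |f x| ≤ 8 * Real.exp (3 / 2 - R / 2) := by
    intro B hB
    rw [← hFint]
    refine le_trans (integral_mono_ae hd.integrable.abs.integrableOn hFi.integrableOn
      (hB.mono hFle)) ?_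
    exact setIntegral_le_integral hFi (Filter.Eventually.of_forall fun x => by
      simp only [hF, Pi.zero_apply]; positivity)
  have hbdd : ∀ x ∈ A, |x - y| ≤ (R + 1) / c := by
    intro x hx
    rw [le_div_iff₀ hcpos]
    have := hdec x hx.1
    have := hx.2
    linarith
  have hAne : A.Nonempty := ⟨y, hy, by linarith⟩
  have hbelow : BddBelow A := ⟨y - (R + 1) / c, fun x hx => by
    linarith [(abs_le.1 (hbdd x hx)).1]⟩
  have habove : BddAbove A := ⟨y + (R + 1) / c, fun x hx => by
    linarith [(abs_le.1 (hbdd x hx)).2]⟩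
  have hsub : Ioo (sInf A) (sSup A) ⊆ A :=
    IsConnected.Ioo_csInf_csSup_subset ⟨hAne, hAconv.isPreconnected⟩ hbelow habove
  refine ⟨H, sInf A, sSup A, csInf_le_csSup hAne hbelow habove,
    hsub.trans fun x hx => hx.1, ?_, ?_, ?_, ?_⟩
  · exact ⟨hd.concave.subset (hsub.trans fun x hx => hx.1) (convex_Ioo _ _),
      fun x hx => hd.eq_exp x (hsub hx).1, fun x hx => (hsub hx).2, fun x hx => hle x (hsub hx).1⟩
  · have h1 : sSup A ≤ y + (R + 1) / c := csSup_le hAne fun x hx => by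
      linarith [(abs_le.1 (hbdd x hx)).2]
    have h2 : y - (R + 1) / c ≤ sInf A := le_csInf hAne fun x hx => by
      linarith [(abs_le.1 (hbdd x hx)).1]
    calc Real.exp H * (sSup A - sInf A) ≤ Real.exp H * (2 * ((R + 1) / c)) := by
          gcongr; linarith
      _ = 4 * Real.exp 1 * (R + 1) := by rw [hc]; field_simp; ring
      _ ≤ 8 * Real.exp 1 * R := by nlinarith [Real.exp_pos 1]
  · refine hFset _ ?_
    rw [← restrict_Iio_eq_restrict_Iic]
    filter_upwards [ae_restrict_mem measurableSet_Iio] with x hx hxA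
    exact not_lt.2 (csInf_le hbelow hxA) hx
  · refine hFset _ ?_
    rw [← restrict_Ioi_eq_restrict_Ici]
    filter_upwards [ae_restrict_mem measurableSet_Ioi] with x hx hxA
    exact not_lt.2 (le_csSup habove hxA) hx

end IsExpConcaveDensity

lemma PiecewiseAffineApprox.of_expConcave {f g : ℝ → ℝ} {S I : Set ℝ}
    (hd : IsExpConcaveDensity f g S) (hI : I.OrdConnected) (hSI : S ⊆ I) {R ε : ℝ} {n : ℕ} (J : ℕ)
    (hε : ε < 1) (hR : 1 ≤ R) (hn : 4 * R ≤ n)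
    (htail : 8 * Real.exp (3 / 2 - R / 2) ≤ ε / 4)
    (hbody : 8 * Real.exp 1 * R * (24 * R ^ 2 / n ^ 2 + 1 / 2 ^ J) ≤ ε / 2) :
    PiecewiseAffineApprox f I (1 + 2 * (J * n + 1) + 1) ε := by
  obtain ⟨H, a, b, hab, hsub, hb, hlen, hl, hr⟩ := hd.exists_truncation hR
  have hf := hd.integrable
  have hab' : a < b := by
    refine lt_of_le_of_ne hab fun heq => ?_
    have h1 := integral_add_compl (measurableSet_Iic (a := a)) hf
    rw [hd.integral_eq_one, compl_Iic, ← integral_Ici_eq_integral_Ioi] at h1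
    simp only [abs_of_nonneg (hd.nonneg _)] at hl hr
    rw [← heq] at hr
    linarith
  have hmono : ∀ B : Set ℝ, ∫ x in I ∩ B, |f x| ≤ ∫ x in B, |f x| := fun B =>
    setIntegral_mono_set hf.abs.integrableOn
      (Filter.Eventually.of_forall fun x => abs_nonneg _)
      (Filter.Eventually.of_forall inter_subset_right)
  have h1 : PiecewiseAffineApprox f (I ∩ Iic a) 1 (ε / 4) :=
    .zero (hI.inter ordConnected_Iic) ((hmono _).trans (hl.trans htail))
  have h3 : PiecewiseAffineApprox f (I ∩ Ici b) 1 (ε / 4) :=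
    .zero (hI.inter ordConnected_Ici) ((hmono _).trans (hr.trans htail))
  have h2 := hb.piecewiseAffineApprox_Ioo hf hR hn hab' J
  have h12 := h1.union hf (hI.inter ordConnected_Iic).measurableSet measurableSet_Ioo
    (Set.disjoint_left.2 fun x hx hx' => not_lt.2 hx.2 hx'.1) h2
  have h123 := h12.union hf ((hI.inter ordConnected_Iic).measurableSet.union measurableSet_Ioo)
    (hI.inter ordConnected_Ici).measurableSet
    (Set.disjoint_left.2 fun x hx hx' => by
      have hbx : b ≤ x := hx'.2
      rcases hx with hx | hx
      · have hxa : x ≤ a := hx.2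
        linarith
      · exact absurd hx.2 (by linarith)) h3
  have hset : I ∩ Iic a ∪ Ioo a b ∪ I ∩ Ici b = I := by
    ext x
    constructor
    · rintro ((hx | hx) | hx)
      · exact hx.1
      · exact hSI (hsub hx)
      · exact hx.1
    · intro hx
      rcases le_or_gt x a with h | h
      · exact Or.inl (Or.inl ⟨hx, h⟩)
      rcases lt_or_ge x b with h' | h'
      · exact Or.inl (Or.inr ⟨h, h'⟩)
      · exact Or.inr ⟨hx, h'⟩
  rw [hset] at h123
  refine h123.mono_error ?_
  have h4 : Real.exp H * (b - a) * (24 * R ^ 2 / n ^ 2 + 1 / 2 ^ J)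
      ≤ 8 * Real.exp 1 * R * (24 * R ^ 2 / n ^ 2 + 1 / 2 ^ J) := by gcongr
  linarith

/-- Rescaling an approximant to total mass one at most doubles the `L¹` error. -/
lemma PiecewiseAffineApprox.exists_normalized {f : ℝ → ℝ} {I : Set ℝ} {t : ℕ} {ε : ℝ}
    (h : PiecewiseAffineApprox f I t ε) (hI : I.OrdConnected) (hf : IntegrableOn f I)
    (hf1 : ∫ x in I, f x = 1) (hε : ε < 1) :
    ∃ g : ℝ → ℝ, IsPiecewisePolyOn I t 1 g ∧ (∀ x ∈ I, 0 ≤ g x) ∧ (∫ x in I, g x) = 1 ∧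
      (1 / 2) * (∫ x in I, |f x - g x|) ≤ ε := by
  obtain ⟨g, ⟨c, hc, hcd, hcI, hcP⟩, hg0, hgi, hge⟩ := h
  have hIm := hI.measurableSet
  set Z := ∫ x in I, g x with hZ
  have hdiff : |1 - Z| ≤ ε := by
    rw [← hf1, hZ, ← integral_sub hf hgi]
    exact (abs_integral_le_integral_abs).trans hge
  have hZpos : 0 < Z := by linarith [(abs_le.1 hdiff).2]
  refine ⟨fun x => g x * Z⁻¹, ⟨c, hc, hcd, hcI, fun i => ?_⟩,
    fun x hx => mul_nonneg (hg0 x hx) (inv_nonneg.2 hZpos.le), ?_, ?_⟩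
  · obtain ⟨P, hP, hPe⟩ := hcP i
    refine ⟨P * Polynomial.C Z⁻¹, (Polynomial.natDegree_mul_C_le _ _).trans hP, fun y hy => ?_⟩
    simp only [Polynomial.eval_mul, Polynomial.eval_C, hPe y hy]
  · rw [integral_mul_const, ← hZ, mul_inv_cancel₀ hZpos.ne']
  · have hi2 : IntegrableOn (fun x => g x * |1 - Z⁻¹|) I := hgi.mul_const _
    have hi1 : IntegrableOn (fun x => |f x - g x|) I := (hf.sub hgi).abs
    have h1 : ∫ x in I, |f x - g x * Z⁻¹| ≤ ∫ x in I, (|f x - g x| + g x * |1 - Z⁻¹|) := by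
      refine setIntegral_mono_on (hf.sub (hgi.mul_const _)).abs (hi1.add hi2) hIm fun x hx => ?_
      have e : f x - g x * Z⁻¹ = (f x - g x) + g x * (1 - Z⁻¹) := by ring
      rw [e]
      refine (abs_add_le _ _).trans (le_of_eq ?_)
      rw [abs_mul, abs_of_nonneg (hg0 x hx)]
    rw [integral_add hi1 hi2, integral_mul_const, ← hZ] at h1
    have h2 : Z * |1 - Z⁻¹| = |1 - Z| := by
      rw [abs_sub_comm 1 Z]
      nth_rewrite 1 [← abs_of_pos hZpos]
      rw [← abs_mul, mul_sub, mul_inv_cancel₀ hZpos.ne', mul_one]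
    linarith

lemma exists_parameters {ε : ℝ} (hε : 0 < ε) (hε2 : ε < 1 / 2) :
    ∃ (R : ℝ) (n J : ℕ), 1 ≤ R ∧ 4 * R ≤ n ∧ 8 * Real.exp (3 / 2 - R / 2) ≤ ε / 4 ∧
      8 * Real.exp 1 * R * (24 * R ^ 2 / n ^ 2 + 1 / 2 ^ J) ≤ ε / 2 ∧
      ((1 + 2 * (J * n + 1) + 1 : ℕ) : ℝ) ≤ 2480000 * Real.log (1 / ε) ^ 3 / Real.sqrt ε := by
  set l := Real.log (1 / ε) with hl
  have hl2 : 0.69 < l := by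
    have h1 : Real.log 2 ≤ l := by
      refine Real.log_le_log (by norm_num) ?_
      rw [le_div_iff₀ hε]; linarith
    linarith [Real.log_two_gt_d9]
  have hexpl : Real.exp l = 1 / ε := Real.exp_log (by positivity)
  set R := 2 * l + 12 with hR
  have hR1 : 1 ≤ R := by linarith
  have hRl : R ≤ 20 * l := by linarith
  have hs0 : 0 < Real.sqrt ε := Real.sqrt_pos.2 hε
  have hs1 : Real.sqrt ε ≤ 1 := Real.sqrt_le_one.2 (by linarith)
  have hsq : Real.sqrt ε ^ 2 = ε := Real.sq_sqrt hε.le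
  have he1 : 2.7 < Real.exp 1 := by linarith [Real.exp_one_gt_d9]
  have he2 : Real.exp 1 < 3 := by linarith [Real.exp_one_lt_d9]
  set n := ⌈50 * R ^ 2 / Real.sqrt ε⌉₊ with hn
  set J := ⌈2 * R⌉₊ with hJ
  have hn1 : 50 * R ^ 2 / Real.sqrt ε ≤ n := Nat.le_ceil _
  have hRs : R ^ 2 ≤ R ^ 2 / Real.sqrt ε := le_div_self (by positivity) hs0 hs1
  have hRR : R ≤ R ^ 2 := by nlinarith
  have e50 : 50 * R ^ 2 / Real.sqrt ε = 50 * (R ^ 2 / Real.sqrt ε) := by ring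
  have hn2 : (n : ℝ) ≤ 51 * (R ^ 2 / Real.sqrt ε) := by
    have := (Nat.ceil_lt_add_one (by positivity : 0 ≤ 50 * R ^ 2 / Real.sqrt ε)).le
    linarith
  have hJ1 : 2 * R ≤ J := Nat.le_ceil _
  have hJ2 : (J : ℝ) ≤ 3 * R := by
    have := (Nat.ceil_lt_add_one (by positivity : 0 ≤ 2 * R)).le
    linarith
  have hn0 : (0 : ℝ) < n := lt_of_lt_of_le (by positivity) hn1
  have e6 : 192 ≤ Real.exp 6 := by
    have h1 : Real.exp 6 = Real.exp 1 ^ 6 := by rw [← Real.exp_nat_mul]; norm_num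
    rw [h1]
    calc (192 : ℝ) ≤ 2.7 ^ 6 := by norm_num
      _ ≤ _ := by gcongr
  have hexpR : Real.exp (R / 2) * ε = Real.exp 6 := by
    have : R / 2 = l + 6 := by rw [hR]; ring
    rw [this, Real.exp_add, hexpl]; field_simp
  refine ⟨R, n, J, hR1, by linarith, ?_, ?_, ?_⟩
  · have h1 : Real.exp (3 / 2 - R / 2) * Real.exp (9 / 2) = ε := by
      rw [← Real.exp_add]
      have : 3 / 2 - R / 2 + 9 / 2 = -l := by rw [hR]; ring
      rw [this, Real.exp_neg, hexpl]; simp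
    have h2 : 32 ≤ Real.exp (9 / 2) := by
      have h3 : Real.exp 4 = Real.exp 1 ^ 4 := by rw [← Real.exp_nat_mul]; norm_num
      calc (32 : ℝ) ≤ 2.7 ^ 4 := by norm_num
        _ ≤ Real.exp 1 ^ 4 := by gcongr
        _ = Real.exp 4 := h3.symm
        _ ≤ _ := Real.exp_le_exp.2 (by norm_num)
    nlinarith [Real.exp_pos (3 / 2 - R / 2)]
  · have h1 : 8 * Real.exp 1 * R * (24 * R ^ 2 / n ^ 2) ≤ ε / 4 := by
      have h2 : 2500 * R ^ 4 / ε ≤ (n : ℝ) ^ 2 := by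
        calc 2500 * R ^ 4 / ε = (50 * R ^ 2 / Real.sqrt ε) ^ 2 := by
              rw [div_pow, hsq]; ring
          _ ≤ _ := by gcongr
      rw [div_le_iff₀ hε] at h2
      have h3 : 8 * Real.exp 1 * R * (24 * R ^ 2 / n ^ 2) = 192 * Real.exp 1 * R ^ 3 / n ^ 2 := by
        ring
      rw [h3, div_le_iff₀ (by positivity)]
      have h4 : R ^ 3 ≤ R ^ 4 := pow_le_pow_right₀ hR1 (by norm_num)
      have h5 : Real.exp 1 * R ^ 3 ≤ 3 * R ^ 4 := by gcongr
      nlinarith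
    have h2 : 8 * Real.exp 1 * R * (1 / 2 ^ J) ≤ ε / 4 := by
      have h3 : Real.exp R ≤ 2 ^ J := by
        have h4 : (2 : ℝ) ^ J = Real.exp (J * Real.log 2) := by
          rw [Real.exp_nat_mul, Real.exp_log (by norm_num)]
        rw [h4]
        refine Real.exp_le_exp.2 ?_
        nlinarith [Real.log_two_gt_d9]
      have h5 : Real.exp R = Real.exp (R / 2) * Real.exp (R / 2) := by
        rw [← Real.exp_add, add_halves]
      have h6 := Real.add_one_le_exp (R / 2)
      rw [mul_one_div, div_le_iff₀ (by positivity)]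
      calc 8 * Real.exp 1 * R ≤ 8 * 3 * (2 * Real.exp (R / 2)) := by
            gcongr; linarith
        _ = 192 / 4 * Real.exp (R / 2) := by ring
        _ ≤ Real.exp 6 / 4 * Real.exp (R / 2) := by gcongr
        _ = ε / 4 * Real.exp R := by rw [← hexpR, h5]; ring
        _ ≤ ε / 4 * 2 ^ J := by gcongr
    rw [mul_add]
    linarith
  · have hX : 1 ≤ R * (R ^ 2 / Real.sqrt ε) := by nlinarith
    have h1 : (J : ℝ) * n ≤ 3 * R * (51 * (R ^ 2 / Real.sqrt ε)) := by gcongr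
    have h2 : R ^ 3 ≤ (20 * l) ^ 3 := by gcongr
    have h3 : 2480000 * l ^ 3 / Real.sqrt ε = 310 * ((20 * l) ^ 3 / Real.sqrt ε) := by ring
    have h4 : R ^ 3 / Real.sqrt ε ≤ (20 * l) ^ 3 / Real.sqrt ε := by gcongr
    have h5 : R * (R ^ 2 / Real.sqrt ε) = R ^ 3 / Real.sqrt ε := by ring
    push_cast
    rw [h3]
    linarith

/-- Lemma lem:lc-struct: every log-concave density on an arbitrary (possibly
infinite) interval admits an (ε,t)-piecewise linear decomposition with
t = Õ(1/√ε). -/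
theorem logconcave_piecewise_linear_decomposition :
    ∃ C c : ℝ, 0 < C ∧ 0 < c ∧
      ∀ I : Set ℝ, I.OrdConnected →
      ∀ f : ℝ → ℝ, IsLogConcaveDensityOn I f →
      ∀ ε : ℝ, 0 < ε → ε < 1 / 2 →
        ∃ (t : ℕ) (g : ℝ → ℝ), 1 ≤ t ∧
          (t : ℝ) ≤ C * (Real.log (1 / ε)) ^ c / Real.sqrt ε ∧
          IsPiecewisePolyOn I t 1 g ∧
          (∀ x ∈ I, 0 ≤ g x) ∧ (∫ x in I, g x) = 1 ∧
          (1 / 2) * (∫ x in I, |f x - g x|) ≤ ε := by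
  refine ⟨2480000, 3, by norm_num, by norm_num, ?_⟩
  rintro I hI f ⟨hnn, hout, hfi, hf1, S, hSI, -, hS0, g, hg, hfg⟩ ε hε hε2
  have hd : IsExpConcaveDensity f g S := by
    refine ⟨hnn, hfi.integrable_of_forall_notMem_eq_zero hout, ?_, hS0, hg, hfg⟩
    rw [← setIntegral_eq_integral_of_forall_compl_eq_zero hout, hf1]
  obtain ⟨R, n, J, hR, hn, htail, hbody, ht⟩ := exists_parameters hε hε2
  obtain ⟨k, hk⟩ := (PiecewiseAffineApprox.of_expConcave hd hI hSI J (by linarith) hR hn htail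
    hbody).exists_normalized hI hfi hf1 (by linarith)
  refine ⟨_, k, by omega, ht.trans (le_of_eq ?_), hk⟩
  rw [← Real.rpow_natCast]
  norm_num
end

section
/- There is a universal constant C > 0 such that for every μ ∈ ℝ, σ > 0, and ε ∈ (0,1/2), the univariate Gaussian density p of N(μ,σ²) satisfies: there exist an integer d ≤ C·log(1/ε) and a 3-piecewise degree-d probability distribution q over ℝ (with density equal to 0 on two unbounded intervals and equal to a polynomial of degree at most d on a bounded middle interval) such that d_TV(p, q) ≤ ε. (Lemma lem:mixGauss.) -/
open MeasureTheory Set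

/-- A Chernoff-type bound on the tail of the exponential series. -/
lemma Real.exp_sub_sum_range_le {u : ℝ} (hu : 0 ≤ u) (n : ℕ) :
    Real.exp u - ∑ k ∈ Finset.range n, u ^ k / k.factorial ≤
      Real.exp (Real.exp 1 * u - n) := by
  have hs (x : ℝ) : HasSum (fun k : ℕ => x ^ k / k.factorial) (Real.exp x) := by
    rw [Real.exp_eq_exp_ℝ]
    exact NormedSpace.expSeries_div_hasSum_exp x
  have h₁ := (hasSum_nat_add_iff' n).mpr (hs u)
  have h₂ := ((hasSum_nat_add_iff' n).mpr (hs (Real.exp 1 * u))).mul_left (Real.exp (-n))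
  have hle := hasSum_le (fun k => ?_) h₁ h₂
  · refine hle.trans ?_
    have hnonneg : 0 ≤ ∑ k ∈ Finset.range n, (Real.exp 1 * u) ^ k / (k.factorial : ℝ) := by
      positivity
    calc Real.exp (-n) * (Real.exp (Real.exp 1 * u) -
          ∑ k ∈ Finset.range n, (Real.exp 1 * u) ^ k / (k.factorial : ℝ))
        ≤ Real.exp (-n) * Real.exp (Real.exp 1 * u) := by
          gcongr
          linarith
      _ = Real.exp (Real.exp 1 * u - n) := by
          rw [← Real.exp_add]
          ring_nf
  · have hexp : Real.exp (-n) * Real.exp 1 ^ (k + n) = Real.exp k := by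
      rw [← Real.exp_nat_mul, ← Real.exp_add]
      push_cast
      ring_nf
    calc u ^ (k + n) / ((k + n).factorial : ℝ)
        ≤ Real.exp k * (u ^ (k + n) / ((k + n).factorial : ℝ)) :=
          le_mul_of_one_le_left (by positivity) (Real.one_le_exp (by positivity))
      _ = Real.exp (-n) * ((Real.exp 1 * u) ^ (k + n) / ((k + n).factorial : ℝ)) := by
          rw [← hexp, mul_pow]
          ring

lemma Real.abs_exp_neg_sub_sum_range_le {u U : ℝ} (hu : 0 ≤ u) (huU : u ≤ U) {n : ℕ}
    (hn : 4 * U ≤ n) :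
    |Real.exp (-u) - ∑ k ∈ Finset.range n, (-u) ^ k / k.factorial| ≤ Real.exp (-U) := by
  have h := Complex.norm_exp_sub_sum_le_exp_norm_sub_sum ((-u : ℝ) : ℂ) n
  rw [Complex.norm_real, Real.norm_eq_abs, abs_neg, abs_of_nonneg hu] at h
  have hcast : Complex.exp ((-u : ℝ) : ℂ) -
      ∑ k ∈ Finset.range n, ((-u : ℝ) : ℂ) ^ k / k.factorial =
      ((Real.exp (-u) - ∑ k ∈ Finset.range n, (-u) ^ k / k.factorial : ℝ) : ℂ) := by
    push_cast
    rfl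
  rw [hcast, Complex.norm_real, Real.norm_eq_abs] at h
  refine h.trans ((Real.exp_sub_sum_range_le hu n).trans (Real.exp_le_exp.mpr ?_))
  nlinarith [Real.exp_one_lt_three]

/-- Normalizing a nonnegative function which is `L¹`-close to a function of integral one
at most doubles the distance. -/
lemma integral_abs_sub_div_integral_le {α : Type*} [MeasurableSpace α] {ν : Measure α}
    {g f : α → ℝ} (hg : Integrable g ν) (hf : Integrable f ν) (hg_one : ∫ x, g x ∂ν = 1)
    (hf_nonneg : ∀ x, 0 ≤ f x) {δ : ℝ} (hδ : δ < 1) (h : ∫ x, |g x - f x| ∂ν ≤ δ) :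
    0 < ∫ x, f x ∂ν ∧ ∫ x, |g x - f x / ∫ y, f y ∂ν| ∂ν ≤ 2 * δ := by
  set Z := ∫ x, f x ∂ν with hZ
  have hdist : |1 - Z| ≤ δ := by
    rw [← hg_one, hZ, ← integral_sub hg hf]
    exact abs_integral_le_integral_abs.trans h
  have hZ_pos : 0 < Z := by linarith [(abs_le.mp hdist).2]
  refine ⟨hZ_pos, ?_⟩
  have hpt (x : α) : |g x - f x / Z| ≤ |g x - f x| + f x * (|1 - Z| / Z) := by
    have heq : |f x - f x / Z| = f x * (|1 - Z| / Z) := by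
      have : f x - f x / Z = f x * (-(1 - Z) / Z) := by
        field_simp
        ring
      rw [this, abs_mul, abs_div, abs_neg, abs_of_nonneg (hf_nonneg x), abs_of_pos hZ_pos]
    rw [← heq]
    exact abs_sub_le _ _ _
  calc ∫ x, |g x - f x / Z| ∂ν
      ≤ ∫ x, (|g x - f x| + f x * (|1 - Z| / Z)) ∂ν :=
        integral_mono (hg.sub (hf.div_const Z)).abs
          ((hg.sub hf).abs.add (hf.mul_const _)) hpt
    _ = (∫ x, |g x - f x| ∂ν) + Z * (|1 - Z| / Z) := by
        have habs : Integrable (fun x => |g x - f x|) ν := (hg.sub hf).abs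
        rw [integral_add habs (hf.mul_const _), integral_mul_const]
    _ = (∫ x, |g x - f x| ∂ν) + |1 - Z| := by
        field_simp
    _ ≤ 2 * δ := by linarith

lemma integral_exp_neg_mul_sub_sq (s μ : ℝ) :
    ∫ x : ℝ, Real.exp (-s * (x - μ) ^ 2) = Real.sqrt (Real.pi / s) := by
  rw [integral_sub_right_eq_self (fun x : ℝ => Real.exp (-s * x ^ 2)) μ, integral_gaussian]

lemma integrable_exp_neg_mul_sub_sq {s : ℝ} (hs : 0 < s) (μ : ℝ) :
    Integrable fun x : ℝ => Real.exp (-s * (x - μ) ^ 2) :=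
  (integrable_exp_neg_mul_sq hs).comp_sub_right μ

/-- The partial sum with `n` terms of the exponential series of `-s * (x - μ) ^ 2`. -/
noncomputable def gaussianTaylor (s μ : ℝ) (n : ℕ) : Polynomial ℝ :=
  ∑ k ∈ Finset.range n, Polynomial.C (1 / (k.factorial : ℝ)) *
    (Polynomial.C (-s) * (Polynomial.X - Polynomial.C μ) ^ 2) ^ k

lemma natDegree_gaussianTaylor_le (s μ : ℝ) (n : ℕ) :
    (gaussianTaylor s μ n).natDegree ≤ 2 * n := by
  refine Polynomial.natDegree_sum_le_of_forall_le _ _ fun k hk => ?_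
  have hk := Finset.mem_range.mp hk
  have hbase : (Polynomial.C (-s) *
      (Polynomial.X - Polynomial.C μ) ^ 2 : Polynomial ℝ).natDegree ≤ 2 := by
    compute_degree
  calc _ ≤ _ := Polynomial.natDegree_C_mul_le _ _
    _ ≤ k * 2 := Polynomial.natDegree_pow_le_of_le k hbase
    _ ≤ 2 * n := by lia

lemma eval_gaussianTaylor (s μ x : ℝ) (n : ℕ) :
    (gaussianTaylor s μ n).eval x =
      ∑ k ∈ Finset.range n, (-(s * (x - μ) ^ 2)) ^ k / k.factorial := by
  simp only [gaussianTaylor, Polynomial.eval_finsetSum, Polynomial.eval_mul,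
    Polynomial.eval_C, Polynomial.eval_pow, Polynomial.eval_sub, Polynomial.eval_X]
  exact Finset.sum_congr rfl fun k _ => by ring

/-- Lemma lem:mixGauss: every univariate Gaussian N(μ,σ²) is ε-close in total
variation distance to a 3-piecewise degree-O(log(1/ε)) distribution over ℝ whose
density vanishes on the two unbounded pieces and is a polynomial on the middle one. -/
theorem gaussian_close_to_piecewise_polynomial :
    ∃ C : ℝ, 0 < C ∧
      ∀ μ σ ε : ℝ, 0 < σ → 0 < ε → ε < 1 / 2 →
        ∃ (d : ℕ) (a b : ℝ) (P : Polynomial ℝ) (q : ℝ → ℝ),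
          (d : ℝ) ≤ C * Real.log (1 / ε) ∧ a ≤ b ∧ P.natDegree ≤ d ∧
          (∀ x, x < a → q x = 0) ∧ (∀ x, b ≤ x → q x = 0) ∧
          (∀ x ∈ Set.Ico a b, q x = P.eval x) ∧
          (∀ x, 0 ≤ q x) ∧ (∫ x, q x) = 1 ∧
          (1 / 2) * (∫ x, |(1 / (σ * Real.sqrt (2 * Real.pi))) *
              Real.exp (-((x - μ) ^ 2) / (2 * σ ^ 2)) - q x|) ≤ ε := by
  refine ⟨40, by norm_num, fun μ σ ε hσ hε hε_half => ?_⟩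
  set L := Real.log (1 / ε) with hL
  have hL_lb : 1 / 2 < L := by
    have : Real.log 2 ≤ L := Real.log_le_log (by norm_num) (by rw [le_div_iff₀ hε]; linarith)
    linarith [Real.log_two_gt_d9]
  have hexpL : Real.exp (-L) = ε := by
    rw [hL, one_div, Real.log_inv, neg_neg, Real.exp_log hε]
  set n := ⌈16 * L⌉₊ with hn
  have hn_lb : 4 * (4 * L) ≤ n := by linarith [Nat.le_ceil (16 * L)]
  have hn_ub : (n : ℝ) < 16 * L + 1 := Nat.ceil_lt_add_one (by linarith)
  set s := 1 / (2 * σ ^ 2) with hs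
  have hs_pos : 0 < s := by positivity
  set c := 1 / (σ * Real.sqrt (2 * Real.pi)) with hc
  have hc_pos : 0 < c := by positivity
  set r := σ * Real.sqrt (8 * L) with hr
  have hr_nonneg : 0 ≤ r := by positivity
  have hr_sq : s * r ^ 2 = 4 * L := by
    rw [hs, hr, mul_pow, Real.sq_sqrt (by linarith)]
    field_simp
    ring
  set P₀ := Polynomial.C c * gaussianTaylor s μ n with hP₀
  set g : ℝ → ℝ := fun x => c * Real.exp (-((x - μ) ^ 2) / (2 * σ ^ 2)) with hg
  have hg_eq (x : ℝ) : g x = c * Real.exp (-s * (x - μ) ^ 2) := by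
    simp only [hg, hs]
    ring_nf
  set f : ℝ → ℝ := (Ico (μ - r) (μ + r)).indicator fun x => P₀.eval x with hf
  have hf_mem {x : ℝ} (hx : x ∈ Ico (μ - r) (μ + r)) :
      f x = c * ∑ k ∈ Finset.range n, (-(s * (x - μ) ^ 2)) ^ k / k.factorial := by
    rw [hf, indicator_of_mem hx, hP₀, Polynomial.eval_mul, Polynomial.eval_C,
      eval_gaussianTaylor]
  have hu_le {x : ℝ} (hx : x ∈ Ico (μ - r) (μ + r)) : s * (x - μ) ^ 2 ≤ 4 * L := by
    rw [← hr_sq]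
    exact mul_le_mul_of_nonneg_left
      (sq_le_sq' (by linarith [hx.1]) (by linarith [hx.2])) hs_pos.le
  have hTaylor {x : ℝ} (hx : x ∈ Ico (μ - r) (μ + r)) :=
    Real.abs_exp_neg_sub_sum_range_le (by positivity : 0 ≤ s * (x - μ) ^ 2) (hu_le hx) hn_lb
  have hf_nonneg (x : ℝ) : 0 ≤ f x := by
    by_cases hx : x ∈ Ico (μ - r) (μ + r)
    · rw [hf_mem hx]
      refine mul_nonneg hc_pos.le ?_
      have h₁ := (abs_le.mp (hTaylor hx)).2
      have h₂ := Real.exp_le_exp.mpr (neg_le_neg (hu_le hx))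
      linarith
    · rw [hf, indicator_of_notMem hx]
  have hpt (x : ℝ) :
      |g x - f x| ≤ c * Real.exp (-(2 * L)) * Real.exp (-(s / 2) * (x - μ) ^ 2) := by
    by_cases hx : x ∈ Ico (μ - r) (μ + r)
    · rw [hg_eq, hf_mem hx, ← mul_sub, abs_mul, abs_of_pos hc_pos, mul_assoc, neg_mul]
      refine mul_le_mul_of_nonneg_left ((hTaylor hx).trans ?_) hc_pos.le
      rw [← Real.exp_add, Real.exp_le_exp]
      linarith [hu_le hx]
    · have hfar : 4 * L ≤ s * (x - μ) ^ 2 := by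
        rw [← hr_sq]
        refine mul_le_mul_of_nonneg_left (sq_le_sq.mpr ?_) hs_pos.le
        rw [abs_of_nonneg hr_nonneg, le_abs']
        by_contra! hcon
        exact hx ⟨by linarith [hcon.1], by linarith [hcon.2]⟩
      rw [hg_eq, hf, indicator_of_notMem hx, sub_zero, abs_of_nonneg (by positivity), mul_assoc]
      refine mul_le_mul_of_nonneg_left ?_ hc_pos.le
      rw [← Real.exp_add, Real.exp_le_exp]
      linarith
  have hg_int : Integrable g :=
    ((integrable_exp_neg_mul_sub_sq hs_pos μ).const_mul c).congr
      (ae_of_all _ fun x => (hg_eq x).symm)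
  have hf_int : Integrable f :=
    ((P₀.continuous.integrableOn_Icc).mono_set Ico_subset_Icc_self).integrable_indicator
      measurableSet_Ico
  have hg_one : ∫ x, g x = 1 := by
    simp_rw [hg_eq]
    rw [integral_const_mul, integral_exp_neg_mul_sub_sq]
    have : Real.pi / s = σ ^ 2 * (2 * Real.pi) := by
      rw [hs]
      field_simp
    rw [this, Real.sqrt_mul (by positivity), Real.sqrt_sq hσ.le, hc]
    exact one_div_mul_cancel (by positivity)
  have hdist : ∫ x, |g x - f x| ≤ ε := by
    calc ∫ x, |g x - f x|
        ≤ ∫ x, c * Real.exp (-(2 * L)) * Real.exp (-(s / 2) * (x - μ) ^ 2) :=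
          integral_mono (hg_int.sub hf_int).abs
            ((integrable_exp_neg_mul_sub_sq (half_pos hs_pos) μ).const_mul _) hpt
      _ = Real.sqrt 2 * ε ^ 2 := by
          rw [integral_const_mul, integral_exp_neg_mul_sub_sq]
          have h₁ : Real.pi / (s / 2) = σ ^ 2 * (2 * Real.pi) * 2 := by
            rw [hs]
            field_simp
          have h₂ : Real.exp (-(2 * L)) = ε ^ 2 := by
            rw [← hexpL, ← Real.exp_nat_mul]
            push_cast
            ring_nf
          rw [h₁, h₂, Real.sqrt_mul (by positivity), Real.sqrt_mul (by positivity),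
            Real.sqrt_sq hσ.le, hc]
          field_simp
      _ ≤ ε := by
          have : Real.sqrt 2 ≤ 2 := Real.sqrt_le_iff.mpr ⟨by norm_num, by norm_num⟩
          nlinarith [mul_le_mul_of_nonneg_right this (sq_nonneg ε)]
  obtain ⟨hZ_pos, hTV⟩ := integral_abs_sub_div_integral_le hg_int hf_int hg_one hf_nonneg
    (by linarith : ε < 1) hdist
  set Z := ∫ x, f x with hZ
  refine ⟨2 * n, μ - r, μ + r, Polynomial.C (1 / Z) * P₀, fun x => f x / Z, ?_, by linarith,
    ?_, fun x hx => ?_, fun x hx => ?_, fun x hx => ?_,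
    fun x => div_nonneg (hf_nonneg x) hZ_pos.le, ?_, by linarith⟩
  · push_cast
    linarith
  · exact (Polynomial.natDegree_C_mul_le _ _).trans ((Polynomial.natDegree_C_mul_le _ _).trans
      (natDegree_gaussianTaylor_le s μ n))
  · simp only [hf, indicator_of_notMem fun h : x ∈ Ico _ _ => hx.not_ge h.1, zero_div]
  · simp only [hf, indicator_of_notMem fun h : x ∈ Ico _ _ => h.2.not_ge hx, zero_div]
  · simp only [hf, indicator_of_mem hx, Polynomial.eval_mul, Polynomial.eval_C]
    ring
  · rw [integral_div, ← hZ, div_self hZ_pos.ne']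
end
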